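/- arXiv:1205.2113 — 3 statements merged into one kernel-verified Lean document; each statement's English description precedes it below -/
import Mathlib

section
/- The pushforward of the additive Haar measure vol on Mat(n, Q_p) under matrix inversion z ↦ z^{-1} (defined on GL(n, Q_p)) equals |det z|_p^{-2n} · vol; equivalently, d vol(z^{-1}) = |det z|_p^{-2n} d vol(z). -/
open MeasureTheory Matrix
open scoped ENNReal NNReal BigOperators

variable {p : ℕ} [Fact p.Prime]

noncomputable instance : MeasurableSpace ℚ_[p] := borel _
instance : BorelSpace ℚ_[p] := ⟨rfl⟩
noncomputable instance (n m : ℕ) : MeasurableSpace (Matrix (Fin n) (Fin m) ℚ_[p]) :=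
  (inferInstance : MeasurableSpace (Fin n → Fin m → ℚ_[p]))
instance (n m : ℕ) : BorelSpace (Matrix (Fin n) (Fin m) ℚ_[p]) :=
  (inferInstance : BorelSpace (Fin n → Fin m → ℚ_[p]))

/-- A matrix over `ℚ_[p]` lies in `GL(·, ℤ_p)`: it has integral entries and an
integral two-sided inverse. -/
def IsGLZp {m : Type*} [Fintype m] [DecidableEq m] (A : Matrix m m ℚ_[p]) : Prop :=
  (∀ i j, ‖A i j‖ ≤ 1) ∧ ∃ B : Matrix m m ℚ_[p],
    (∀ i j, ‖B i j‖ ≤ 1) ∧ A * B = 1 ∧ B * A = 1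

/-- Smith normal form over `ℤ_p`: `z = A * diagonal d * B` with `A, B ∈ GL(n, ℤ_p)`
and each diagonal entry `d j` equal to `0` or to a power `p^(-k_j)` of `p`. -/
def IsSmith {n : ℕ} (z : Matrix (Fin n) (Fin n) ℚ_[p])
    (A : Matrix (Fin n) (Fin n) ℚ_[p]) (d : Fin n → ℚ_[p])
    (B : Matrix (Fin n) (Fin n) ℚ_[p]) : Prop :=
  IsGLZp A ∧ IsGLZp B ∧ (∀ j, d j = 0 ∨ ∃ k : ℤ, d j = (p : ℚ_[p]) ^ (-k)) ∧
    z = A * Matrix.diagonal d * B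

open Classical in
/-- `γ(z) = ∏_{k_j > 0} p^{k_j}`, computed from a Smith normal form
`z = A diag(p^{-k_1},…,p^{-k_n}) B`: indeed `max(‖d j‖, 1) = p^{k_j}` when `k_j > 0`
and `= 1` otherwise. -/
noncomputable def gammaFn {n : ℕ} (z : Matrix (Fin n) (Fin n) ℚ_[p]) : ℝ :=
  if h : ∃ A d B, IsSmith z A d B then ∏ j, max ‖h.choose_spec.choose j‖ 1 else 1

/-- The constant `c(n, α) = ∏_{j=1}^n (1-p^{-α+n-j})/(1-p^{-α+n+j-1})`. -/
noncomputable def cConst (p n : ℕ) (α : ℝ) : ℝ :=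
  ∏ j ∈ Finset.range n,
    (1 - (p : ℝ) ^ (-α + n - (j + 1 : ℕ))) / (1 - (p : ℝ) ^ (-α + n + (j + 1 : ℕ) - 1))

/-- The Hua measure `μ_s^n` with density `c(n, s+2n)^{-1} γ(z)^{-s-2n}`
against the additive Haar measure `vol`. -/
noncomputable def huaMeasure (p : ℕ) [Fact p.Prime] (n : ℕ) (s : ℝ)
    (vol : Measure (Matrix (Fin n) (Fin n) ℚ_[p])) :
    Measure (Matrix (Fin n) (Fin n) ℚ_[p]) :=
  vol.withDensity fun z =>
    ENNReal.ofReal ((cConst p n (s + 2 * n))⁻¹ * gammaFn z ^ (-(s + 2 * n)))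


section helpers
open scoped Pointwise

abbrev MM (p n : ℕ) [Fact p.Prime] := Matrix (Fin n) (Fin n) ℚ_[p]
abbrev GG (p n : ℕ) [Fact p.Prime] := (Matrix (Fin n) (Fin n) ℚ_[p])ˣ

instance instLC (n : ℕ) : LocallyCompactSpace (Matrix (Fin n) (Fin n) ℚ_[p]) :=
  inferInstanceAs (LocallyCompactSpace (Fin n → Fin n → ℚ_[p]))
instance instSC (n : ℕ) : SecondCountableTopology (Matrix (Fin n) (Fin n) ℚ_[p]) :=
  inferInstanceAs (SecondCountableTopology (Fin n → Fin n → ℚ_[p]))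
instance instT2 (n : ℕ) : T2Space (Matrix (Fin n) (Fin n) ℚ_[p]) :=
  inferInstanceAs (T2Space (Fin n → Fin n → ℚ_[p]))
instance instCSU (n : ℕ) : ContinuousConstSMul (GG p n) (MM p n) where
  continuous_const_smul g := by
    have : Continuous (fun z : MM p n => (g : MM p n) * z) := by fun_prop
    exact this

/-- the character -/
noncomputable def chi (p n : ℕ) [Fact p.Prime] : GG p n →* ℝ≥0 := distribHaarChar (MM p n)

def OO (p n : ℕ) [Fact p.Prime] : Set (MM p n) := {z | ∀ i j, ‖z i j‖ ≤ 1}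

theorem chi_mul (n : ℕ) (vol : Measure (MM p n)) [vol.IsAddHaarMeasure] (g : GG p n)
    (s : Set (MM p n)) : vol (g • s) = chi p n g * vol s := 
  (distribHaarChar_mul vol g s).symm

theorem chi_ne (n : ℕ) (g : GG p n) : chi p n g ≠ 0 := (distribHaarChar_pos).ne'

theorem chi_transvec (n : ℕ) (t : TransvectionStruct (Fin n) ℚ_[p]) (u : GG p n)
    (hu : (u : MM p n) = t.toMatrix) : chi p n u = 1 := by
  have hd : IsUnit (Matrix.diagonal (Function.update (1 : Fin n → ℚ_[p]) t.i 2)) := by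
    rw [Matrix.isUnit_iff_isUnit_det, Matrix.det_diagonal, isUnit_iff_ne_zero, Finset.prod_ne_zero_iff]
    intro a _
    rcases eq_or_ne a t.i with h | h
    · subst h; simp
    · simp [h]
  obtain ⟨d, hd⟩ := hd
  have key : d * u = u * u * d := by
    ext1
    push_cast
    rw [hu, hd]
    obtain ⟨i, j, hij, c⟩ := t
    simp only [TransvectionStruct.toMatrix, Matrix.transvection_mul_transvection_same i j hij]
    ext a b
    simp only [Matrix.diagonal_mul, Matrix.mul_diagonal, Matrix.transvection, Matrix.add_apply,
      Matrix.single_apply, Matrix.one_apply, Function.update_apply]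
    by_cases ha : a = i
    · subst ha
      by_cases hb : j = b
      · subst hb
        simp [hij, Ne.symm hij]
        ring
      · simp only [hb, and_false, if_false, add_zero]
        by_cases hab : a = b
        · subst hab; simp
        · simp [hab]
    · have ha2 : ¬ (i = a) := fun h => ha h.symm
      simp only [ha, ha2, false_and, if_false, add_zero]
      by_cases hab : a = b
      · subst hab; simp [ha]
      · simp [hab]
  have := congrArg (chi p n) key
  simp only [map_mul] at this
  have h1 := chi_ne n d
  have h2 := chi_ne n u
  rw [mul_comm (chi p n d)] at this
  have := mul_right_cancel₀ h1 this
  have := mul_left_cancel₀ h2 ((mul_one _).trans this)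
  exact this.symm

/-- diagonal unit -/
noncomputable def dg (n : ℕ) : (Fin n → (ℚ_[p])ˣ) →* GG p n where
  toFun a := ⟨Matrix.diagonal (fun i => (a i : ℚ_[p])), Matrix.diagonal (fun i => ((a i)⁻¹ : ℚ_[p])),
    by simp [Matrix.diagonal_mul_diagonal], by simp [Matrix.diagonal_mul_diagonal]⟩
  map_one' := by ext1; simp
  map_mul' a b := by ext1; simp [Matrix.diagonal_mul_diagonal]

theorem chi_perm (n : ℕ) (i j : Fin n) (a : (ℚ_[p])ˣ) :
    chi p n (dg n (Pi.mulSingle i a)) = chi p n (dg n (Pi.mulSingle j a)) := by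
  have hw : IsUnit ((Equiv.swap i j).permMatrix ℚ_[p]) := by
    rw [Matrix.isUnit_iff_isUnit_det, Matrix.det_permutation]
    rcases Int.units_eq_one_or (Equiv.Perm.sign (Equiv.swap i j)) with h | h <;> simp [h]
  obtain ⟨w, hw⟩ := hw
  have key : w * dg n (Pi.mulSingle i a) = dg n (Pi.mulSingle j a) * w := by
    ext1
    push_cast
    rw [hw]
    simp only [dg, MonoidHom.coe_mk, OneHom.coe_mk]
    ext k l
    simp only [Matrix.mul_diagonal, Matrix.diagonal_mul, Equiv.Perm.permMatrix, PEquiv.toMatrix_apply,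
      Equiv.toPEquiv_apply, Pi.mulSingle_apply, Option.mem_def, Option.some.injEq]
    rcases eq_or_ne (Equiv.swap i j k) l with h | h
    · have : l = i ↔ k = j := by
        rw [← h, Equiv.swap_apply_eq_iff, Equiv.swap_apply_left]
      simp [h, this]
    · simp [h]
  have := congrArg (chi p n) key
  simp only [map_mul] at this
  rw [mul_comm] at this
  exact mul_right_cancel₀ (chi_ne n w) this

theorem OO_open (n : ℕ) : IsOpen (OO p n) := by
  simp only [OO, Set.ofPred_forall]
  refine isOpen_iInter_of_finite fun i => isOpen_iInter_of_finite fun j => ?_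
  have : Continuous (fun z : MM p n => z i j) := by fun_prop
  have h2 := (IsUltrametricDist.isOpen_closedBall (0 : ℚ_[p]) one_ne_zero).preimage this
  simpa [Set.preimage, Metric.mem_closedBall] using h2

theorem chi_of (n : ℕ) (vol : Measure (MM p n)) [vol.IsAddHaarMeasure] 
    (hnorm : vol (OO p n) = 1) (g : GG p n) : (chi p n g : ℝ≥0∞) = vol (g • OO p n) := by
  rw [chi_mul, hnorm, mul_one]

theorem chi_unit (n : ℕ) (vol : Measure (MM p n)) [vol.IsAddHaarMeasure] 
    (hnorm : vol (OO p n) = 1) (a : (ℚ_[p])ˣ) (ha : ‖(a : ℚ_[p])‖ = 1) :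
    chi p n (dg n (fun _ => a)) = 1 := by
  have := chi_of n vol hnorm (dg n (fun _ => a))
  have h2 : dg n (fun _ => a) • OO p n = OO p n := by
    ext z
    rw [Set.mem_smul_set_iff_inv_smul_mem, ← map_inv]
    simp [OO, dg, Units.smul_def, ha]
  rw [h2, hnorm] at this
  exact_mod_cast this

noncomputable def pu (p : ℕ) [Fact p.Prime] : (ℚ_[p])ˣ :=
  Units.mk0 (p : ℚ_[p]) (by exact_mod_cast (Fact.out : p.Prime).ne_zero)

theorem digit (x : ℚ_[p]) (hx : ‖x‖ ≤ 1) : ∃! k : Fin p, ‖x - (k : ℕ)‖ ≤ (p : ℝ)⁻¹ := by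
  obtain ⟨y, rfl⟩ : ∃ y : ℤ_[p], (y : ℚ_[p]) = x := ⟨⟨x, hx⟩, rfl⟩
  have key : ∀ k : ℕ, ‖(y : ℚ_[p]) - (k : ℕ)‖ ≤ (p : ℝ)⁻¹ ↔
      y - k ∈ IsLocalRing.maximalIdeal ℤ_[p] := by
    intro k
    rw [PadicInt.maximalIdeal_eq_span_p]
    have := PadicInt.norm_le_pow_iff_mem_span_pow (y - (k : ℤ_[p])) 1
    simp only [pow_one] at this
    rw [← this, PadicInt.norm_def]
    simp
  obtain ⟨k, ⟨h1, h2⟩, h3⟩ := PadicInt.existsUnique_mem_range y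
  refine ⟨⟨k, h1⟩, (key k).2 h2, ?_⟩
  intro l hl
  ext
  exact h3 l ⟨l.2, (key l).1 hl⟩

theorem chi_p (n : ℕ) (vol : Measure (MM p n)) [vol.IsAddHaarMeasure] 
    (hnorm : vol (OO p n) = 1) :
    (chi p n (dg n (fun _ => pu p)) : ℝ) = (p : ℝ)⁻¹ ^ (n ^ 2) := by
  have hp : (0 : ℝ) < p := by exact_mod_cast (Fact.out : p.Prime).pos
  have h1 := chi_of n vol hnorm (dg n (fun _ => pu p))
  set S := dg n (fun _ => pu p) • OO p n with hS
  have hmem : ∀ z, z ∈ S ↔ ∀ i j, ‖z i j‖ ≤ (p : ℝ)⁻¹ := by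
    intro z
    rw [hS, Set.mem_smul_set_iff_inv_smul_mem, ← map_inv]
    simp only [OO, dg, Units.smul_def, pu]
    simp
    refine forall_congr' fun i => forall_congr' fun j => ?_
    rw [mul_comm, ← le_div_iff₀ hp, one_div]
  let em : (Fin n → Fin n → Fin p) → MM p n := fun f => Matrix.of fun i j => ((f i j : ℕ) : ℚ_[p])
  have hU : OO p n = ⋃ f, (em f) +ᵥ S := by
    ext z
    simp only [Set.mem_iUnion, Set.mem_vadd_set_iff_neg_vadd_mem, hmem]
    simp only [OO, Set.mem_ofPred_eq, vadd_eq_add, Matrix.add_apply, Matrix.neg_apply, em,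
      Matrix.of_apply, neg_add_eq_sub]
    constructor
    · intro hz
      choose f hf using fun i j => (digit (z i j) (hz i j)).exists
      exact ⟨f, hf⟩
    · rintro ⟨f, hf⟩ i j
      have h3 : ‖((f i j : ℕ) : ℚ_[p])‖ ≤ 1 := by
        simpa using Padic.norm_int_le_one (p := p) (f i j : ℕ)
      have h4 : (p : ℝ)⁻¹ ≤ 1 := inv_le_one_of_one_le₀ (by exact_mod_cast (Fact.out : p.Prime).one_le)
      have := Padic.nonarchimedean (z i j - ((f i j : ℕ) : ℚ_[p])) ((f i j : ℕ) : ℚ_[p])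
      rw [sub_add_cancel] at this
      exact this.trans (max_le ((hf i j).trans h4) h3)
  have hdisj : Pairwise (Function.onFun Disjoint fun f => (em f) +ᵥ S) := by
    intro f g hfg
    rw [Function.onFun, Set.disjoint_left]
    intro z hz1 hz2
    apply hfg
    have hz : z ∈ OO p n := by rw [hU]; exact Set.mem_iUnion.2 ⟨f, hz1⟩
    rw [Set.mem_vadd_set_iff_neg_vadd_mem, hmem] at hz1 hz2
    simp only [vadd_eq_add, Matrix.add_apply, Matrix.neg_apply, em,
      Matrix.of_apply, neg_add_eq_sub] at hz1 hz2
    funext i j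
    exact (digit (z i j) (hz i j)).unique (hz1 i j) (hz2 i j)
  have hSo : IsOpen S := (OO_open n).smul _
  have hm : ∀ f, MeasurableSet ((em f) +ᵥ S) := fun f => (hSo.vadd _).measurableSet
  have h2 : vol (OO p n) = ∑' f, vol ((em f) +ᵥ S) := by
    conv_lhs => rw [hU]
    exact measure_iUnion hdisj hm
  simp only [measure_vadd, tsum_fintype, Finset.sum_const, Finset.card_univ, hnorm, ← h1] at h2
  have h3 : (1 : ℝ) = Fintype.card (Fin n → Fin n → Fin p) • (chi p n (dg n (fun _ => pu p)) : ℝ) := by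
    have h4 := congrArg ENNReal.toReal h2
    simpa using h4
  simp only [Fintype.card_pi, Finset.prod_const, Finset.card_univ, Fintype.card_fin, nsmul_eq_mul] at h3
  push_cast at h3
  rw [← pow_mul, ← sq] at h3
  rw [inv_pow]
  exact eq_inv_of_mul_eq_one_right h3.symm

theorem chi_scalar (n : ℕ) (vol : Measure (MM p n)) [vol.IsAddHaarMeasure] 
    (hnorm : vol (OO p n) = 1) (a : (ℚ_[p])ˣ) :
    (chi p n (dg n (fun _ => a)) : ℝ) = ‖(a : ℚ_[p])‖ ^ (n ^ 2) := by
  have hp0 : (p : ℝ) ≠ 0 := by exact_mod_cast (Fact.out : p.Prime).ne_zero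
  obtain ⟨k, hk⟩ : ∃ k : ℤ, ‖(a : ℚ_[p])‖ = (p : ℝ) ^ (-k) :=
    ⟨_, Padic.norm_eq_zpow_neg_valuation a.ne_zero⟩
  have hpk : ‖((pu p ^ k : (ℚ_[p])ˣ) : ℚ_[p])‖ = (p : ℝ) ^ (-k) := by
    simp [pu]
  have hb : ‖((a * (pu p ^ k)⁻¹ : (ℚ_[p])ˣ) : ℚ_[p])‖ = 1 := by
    rw [Units.val_mul, norm_mul, hk, Units.val_inv_eq_inv_val, norm_inv, hpk]
    exact mul_inv_cancel₀ (zpow_ne_zero _ hp0)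
  have e : (fun _ : Fin n => a) = (fun _ => a * (pu p ^ k)⁻¹) * (fun _ => pu p) ^ k := by
    funext i; simp
  rw [e, map_mul, map_mul, chi_unit n vol hnorm _ hb, map_zpow, map_zpow, one_mul, NNReal.coe_zpow,
    chi_p n vol hnorm, hk]
  simp only [inv_pow, _root_.inv_zpow, _root_.zpow_neg]
  refine congrArg _ ?_
  rw [← zpow_natCast, ← zpow_natCast, ← _root_.zpow_mul, ← _root_.zpow_mul, mul_comm]

theorem chi_dg (n : ℕ) (vol : Measure (MM p n)) [vol.IsAddHaarMeasure] 
    (hnorm : vol (OO p n) = 1) (a : Fin n → (ℚ_[p])ˣ) :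
    (chi p n (dg n a) : ℝ) = (∏ i, ‖(a i : ℚ_[p])‖) ^ n := by
  have hpr : ∀ f : Fin n → (Fin n → (ℚ_[p])ˣ), chi p n (dg n (∏ i, f i)) =
      ∏ i, chi p n (dg n (f i)) := fun f => map_prod ((chi p n).comp (dg n)) f Finset.univ
  have hs : ∀ (i : Fin n) (b : (ℚ_[p])ˣ), (chi p n (dg n (Pi.mulSingle i b)) : ℝ) = ‖(b : ℚ_[p])‖ ^ n := by
    intro i b
    have h1 := chi_scalar n vol hnorm b
    rw [← Finset.univ_prod_mulSingle (fun _ : Fin n => b), hpr,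
      Finset.prod_congr rfl (fun j _ => chi_perm n j i b)] at h1
    simp only [Finset.prod_const, Finset.card_univ, Fintype.card_fin, NNReal.coe_pow] at h1
    rw [sq, pow_mul] at h1
    exact (pow_left_inj₀ (NNReal.coe_nonneg _) (by positivity) (Fin.pos i).ne').1 h1
  conv_lhs => rw [← Finset.univ_prod_mulSingle a, hpr]
  push_cast
  simp only [hs, Finset.prod_pow]

theorem chi_eq (n : ℕ) (vol : Measure (MM p n)) [vol.IsAddHaarMeasure] 
    (hnorm : vol (OO p n) = 1) (g : GG p n) :
    (chi p n g : ℝ) = ‖(g : MM p n).det‖ ^ n := by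
  have hgd : ∀ g : GG p n, (g : MM p n).det ≠ 0 := fun g =>
    ((Matrix.isUnit_iff_isUnit_det _).1 g.isUnit).ne_zero
  suffices H : ∀ u : GG p n, (u : MM p n) = g → (chi p n u : ℝ) = ‖(g : MM p n).det‖ ^ n from H g rfl
  refine Matrix.diagonal_transvection_induction_of_det_ne_zero
    (fun M => ∀ u : GG p n, (u : MM p n) = M → (chi p n u : ℝ) = ‖M.det‖ ^ n) _ (hgd g) ?_ ?_ ?_
  · intro D hD u hu
    rw [Matrix.det_diagonal, Finset.prod_ne_zero_iff] at hD
    have : u = dg n (fun i => Units.mk0 (D i) (hD i (Finset.mem_univ _))) := by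
      ext1; rw [hu]; simp [dg]
    rw [this, chi_dg n vol hnorm]
    simp [Matrix.det_diagonal]
  · intro t u hu
    rw [chi_transvec n t u hu]
    simp
  · intro A B hA hB PA PB u hu
    obtain ⟨a, ha⟩ := (Matrix.isUnit_iff_isUnit_det A).2 hA.isUnit
    obtain ⟨b, hb⟩ := (Matrix.isUnit_iff_isUnit_det B).2 hB.isUnit
    have : u = a * b := by ext1; rw [hu, Units.val_mul, ha, hb]
    rw [this, map_mul, NNReal.coe_mul, PA a ha, PB b hb, Matrix.det_mul, norm_mul, mul_pow]

theorem map_left (n : ℕ) (vol : Measure (MM p n)) [vol.IsAddHaarMeasure]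
    (hnorm : vol (OO p n) = 1) (g : GG p n) :
    Measure.map (fun z : MM p n => (g : MM p n) * z) vol =
      ENNReal.ofReal (‖(g : MM p n).det‖ ^ (-(n : ℤ))) • vol := by
  ext s hs
  have hc : Continuous (fun z : MM p n => (g : MM p n) * z) := by fun_prop
  rw [Measure.map_apply hc.measurable hs, Measure.smul_apply, smul_eq_mul]
  have : (fun z : MM p n => (g : MM p n) * z) ⁻¹' s = g⁻¹ • s := by
    ext z
    rw [Set.mem_smul_set_iff_inv_smul_mem, inv_inv]
    rfl
  rw [this, chi_mul]
  congr 1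
  rw [← ENNReal.ofReal_coe_nnreal, map_inv, NNReal.coe_inv, chi_eq n vol hnorm, _root_.zpow_neg,
    zpow_natCast]

theorem map_tr (n : ℕ) (vol : Measure (MM p n)) [vol.IsAddHaarMeasure]
    (hnorm : vol (OO p n) = 1) :
    Measure.map (fun z : MM p n => zᵀ) vol = vol := by
  have hc : Continuous (fun z : MM p n => zᵀ) := by fun_prop
  have : (Measure.map (fun z : MM p n => zᵀ) vol).IsAddHaarMeasure :=
    (Matrix.transposeAddEquiv (Fin n) (Fin n) ℚ_[p]).isAddHaarMeasure_map vol hc hc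
  have h := Measure.isAddLeftInvariant_eq_smul (Measure.map (fun z : MM p n => zᵀ) vol) vol
  have h2 := congrArg (fun m => m (OO p n)) h
  simp only [Measure.map_apply hc.measurable (OO_open n).measurableSet] at h2
  have h3 : (fun z : MM p n => zᵀ) ⁻¹' OO p n = OO p n := by
    ext z
    simp only [OO, Set.mem_preimage, Set.mem_ofPred_eq, Matrix.transpose_apply]
    exact forall_comm
  rw [h3, hnorm, Measure.smul_apply, hnorm] at h2
  have h4 : Measure.addHaarScalarFactor (Measure.map (fun z : MM p n => zᵀ) vol) vol = 1 := by
    rw [ENNReal.smul_def, smul_eq_mul, mul_one] at h2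
    exact_mod_cast h2.symm
  rw [h, h4, one_smul]

theorem map_right (n : ℕ) (vol : Measure (MM p n)) [vol.IsAddHaarMeasure]
    (hnorm : vol (OO p n) = 1) (g : GG p n) :
    Measure.map (fun z : MM p n => z * (g : MM p n)) vol =
      ENNReal.ofReal (‖(g : MM p n).det‖ ^ (-(n : ℤ))) • vol := by
  obtain ⟨h, hh⟩ : ∃ h : GG p n, (h : MM p n) = (g : MM p n)ᵀ := by
    have : IsUnit (g : MM p n)ᵀ := by
      rw [Matrix.isUnit_iff_isUnit_det, Matrix.det_transpose, ← Matrix.isUnit_iff_isUnit_det]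
      exact g.isUnit
    exact this
  have hc : Continuous (fun z : MM p n => zᵀ) := by fun_prop
  have hl : Continuous (fun z : MM p n => (h : MM p n) * z) := by fun_prop
  have e : (fun z : MM p n => z * (g : MM p n)) =
      (fun z => zᵀ) ∘ (fun z => (h : MM p n) * z) ∘ (fun z => zᵀ) := by
    funext z
    simp [hh, Matrix.transpose_mul]
  rw [e, ← Measure.map_map hc.measurable (hl.measurable.comp hc.measurable),
    ← Measure.map_map hl.measurable hc.measurable, map_tr n vol hnorm, map_left n vol hnorm,
    Measure.map_smul, map_tr n vol hnorm, hh, Matrix.det_transpose]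

theorem det_cont (n : ℕ) : Continuous (fun z : MM p n => z.det) := by fun_prop

noncomputable def DD (p n : ℕ) [Fact p.Prime] (z : MM p n) : ℝ≥0 := ‖z.det‖₊ ^ (-(n : ℤ))

theorem DD_meas (n : ℕ) : Measurable (DD p n) := by
  unfold DD
  have : Measurable (fun z : MM p n => ‖z.det‖₊) := (det_cont n).nnnorm.measurable
  simp only [_root_.zpow_neg, zpow_natCast]
  exact (this.pow_const n).inv

noncomputable def nuM (n : ℕ) (vol : Measure (MM p n)) : Measure (MM p n) :=
  vol.withDensity (fun z => (DD p n z : ℝ≥0∞))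

theorem nu_inv (n : ℕ) (vol : Measure (MM p n)) (g : GG p n) (e : MM p n → MM p n)
    (he : Measurable e) (hdet : ∀ z, (e z).det = (g : MM p n).det * z.det)
    (hm : Measure.map e vol = ENNReal.ofReal (‖(g : MM p n).det‖ ^ (-(n : ℤ))) • vol) :
    Measure.map e (nuM n vol) = nuM n vol := by
  have hg : (g : MM p n).det ≠ 0 := ((Matrix.isUnit_iff_isUnit_det _).1 g.isUnit).ne_zero
  have hc : ENNReal.ofReal (‖(g : MM p n).det‖ ^ (-(n : ℤ))) = (DD p n g : ℝ≥0∞) := by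
    rw [← ENNReal.ofReal_coe_nnreal]; simp [DD]
  have hD0 : DD p n g ≠ 0 := zpow_ne_zero _ (by simpa using hg)
  have hD : ∀ z, DD p n z = (DD p n g)⁻¹ * DD p n (e z) := by
    intro z
    have : DD p n (e z) = DD p n g * DD p n z := by simp [DD, hdet, mul_pow, mul_comm]
    rw [this, inv_mul_cancel_left₀ hD0]
  rw [hc] at hm
  have hDm : Measurable (fun z => (DD p n z : ℝ≥0∞)) := (DD_meas n).coe_nnreal_ennreal
  ext s hs
  rw [Measure.map_apply he hs, nuM, withDensity_apply _ (he hs), withDensity_apply _ hs]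
  calc ∫⁻ z in e ⁻¹' s, (DD p n z : ℝ≥0∞) ∂vol
      = ∫⁻ z in e ⁻¹' s, (((DD p n g)⁻¹ : ℝ≥0) : ℝ≥0∞) * (DD p n (e z) : ℝ≥0∞) ∂vol := by
        refine lintegral_congr fun z => ?_
        rw [← ENNReal.coe_mul, ← hD]
    _ = (((DD p n g)⁻¹ : ℝ≥0) : ℝ≥0∞) * ∫⁻ z in e ⁻¹' s, (DD p n (e z) : ℝ≥0∞) ∂vol :=
        lintegral_const_mul _ (hDm.comp he)
    _ = (((DD p n g)⁻¹ : ℝ≥0) : ℝ≥0∞) * ∫⁻ z in s, (DD p n z : ℝ≥0∞) ∂(Measure.map e vol) := by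
        rw [setLIntegral_map hs hDm he]
    _ = _ := by
        rw [hm, Measure.restrict_smul, lintegral_smul_measure, smul_eq_mul, ← mul_assoc,
          ← ENNReal.coe_mul, inv_mul_cancel₀ hD0, ENNReal.coe_one, one_mul]

theorem unit_iff (n : ℕ) (z : MM p n) : IsUnit z ↔ z.det ≠ 0 := by
  rw [Matrix.isUnit_iff_isUnit_det, isUnit_iff_ne_zero]

theorem N_meas (n : ℕ) : MeasurableSet {z : MM p n | IsUnit z} := by
  have : IsOpen {z : MM p n | z.det ≠ 0} := isOpen_ne_fun (det_cont n) continuous_const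
  simpa only [unit_iff] using this.measurableSet

theorem val_emb (n : ℕ) : MeasurableEmbedding (Units.val : GG p n → MM p n) where
  injective := Units.val_injective
  measurable := comap_measurable _
  measurableSet_image' := by
    rintro _ ⟨t, ht, rfl⟩
    rw [Set.image_preimage_eq_inter_range]
    exact ht.inter (N_meas n)

theorem meas_units {α : Type*} [MeasurableSpace α] (n : ℕ) (f : α → GG p n)
    (h : Measurable (fun a => (f a : MM p n))) : Measurable f :=
  (val_emb n).measurable_comp_iff.1 h

theorem inv_meas (n : ℕ) : Measurable (fun z : MM p n => z⁻¹) := by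
  have h : (fun z : MM p n => z⁻¹) = fun z => (z.det)⁻¹ • z.adjugate := by
    funext z; rw [Matrix.inv_def, Ring.inverse_eq_inv]
  rw [h]
  have h1 : Continuous (fun z : MM p n => z.adjugate) := by fun_prop
  refine measurable_pi_iff.2 fun i => measurable_pi_iff.2 fun j => ?_
  have h2 : Continuous (fun z : MM p n => z.adjugate i j) := by fun_prop
  exact (det_cont n).measurable.inv.mul h2.measurable

instance instMM2 (n : ℕ) : MeasurableMul₂ (GG p n) where
  measurable_mul := by
    apply meas_units
    have h : Continuous (fun z : MM p n × MM p n => z.1 * z.2) := by fun_prop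
    exact h.measurable.comp ((val_emb n).measurable.prodMap (val_emb n).measurable)

instance instMI (n : ℕ) : MeasurableInv (GG p n) where
  measurable_inv := by
    apply meas_units
    simp only [Matrix.coe_units_inv]
    exact (inv_meas n).comp (val_emb n).measurable

noncomputable def lam (n : ℕ) (vol : Measure (MM p n)) : Measure (GG p n) :=
  Measure.comap Units.val (nuM n vol)

theorem map_val_lam (n : ℕ) (vol : Measure (MM p n)) :
    Measure.map Units.val (lam n vol) = (nuM n vol).restrict {z | IsUnit z} :=
  (val_emb n).map_comap _

theorem map_val_inj (n : ℕ) (a b : Measure (GG p n))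
    (h : Measure.map Units.val a = Measure.map Units.val b) : a = b := by
  rw [← (val_emb n).comap_map a, h, (val_emb n).comap_map]

theorem lam_inv (n : ℕ) (vol : Measure (MM p n)) (f : GG p n → GG p n) (hf : Measurable f)
    (e : MM p n → MM p n)
    (he : Measurable e) (hfe : ∀ g : GG p n, (f g : MM p n) = e g)
    (hu : ∀ z, IsUnit (e z) ↔ IsUnit z)
    (hm : Measure.map e (nuM n vol) = nuM n vol) :
    Measure.map f (lam n vol) = lam n vol := by
  apply map_val_inj
  have hc : Units.val ∘ f = e ∘ Units.val := funext hfe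
  rw [Measure.map_map (val_emb n).measurable hf, hc, ← Measure.map_map he (val_emb n).measurable,
    map_val_lam]
  conv_rhs => rw [← hm, Measure.restrict_map he (N_meas n)]
  congr 2
  ext z
  exact (hu z).symm

theorem lam_left (n : ℕ) (vol : Measure (MM p n)) [vol.IsAddHaarMeasure]
    (hnorm : vol (OO p n) = 1) : (lam n vol).IsMulLeftInvariant where
  map_mul_left_eq_self g := by
    have hl : Continuous (fun z : MM p n => (g : MM p n) * z) := by fun_prop
    refine lam_inv n vol _ (measurable_const_mul g) _ hl.measurable (fun _ => rfl) ?_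
      (nu_inv n vol g _ hl.measurable ?_ (map_left n vol hnorm g))
    · intro z; exact g.isUnit_units_mul z
    · intro z; simp

theorem lam_right (n : ℕ) (vol : Measure (MM p n)) [vol.IsAddHaarMeasure]
    (hnorm : vol (OO p n) = 1) : (lam n vol).IsMulRightInvariant where
  map_mul_right_eq_self g := by
    have hl : Continuous (fun z : MM p n => z * (g : MM p n)) := by fun_prop
    refine lam_inv n vol _ (measurable_mul_const g) _ hl.measurable (fun _ => rfl) ?_
      (nu_inv n vol g _ hl.measurable ?_ (map_right n vol hnorm g))
    · intro z; exact Units.isUnit_mul_units z g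
    · intro z; simp [mul_comm]

/-- The copy of `GL(n, ℤ_p)` in `GL(n, ℚ_p)`. -/
def KK (p n : ℕ) [Fact p.Prime] : Set (GG p n) :=
  {g | (g : MM p n) ∈ OO p n ∧ ‖(g : MM p n).det‖ = 1}

theorem det_int (n : ℕ) (z : MM p n) (hz : z ∈ OO p n) : ‖z.det‖ ≤ 1 := by
  have : z = (Matrix.of fun i j => (⟨z i j, hz i j⟩ : ℤ_[p])).map (PadicInt.Coe.ringHom (p := p)) := by
    ext i j; rfl
  rw [this]
  erw [← RingHom.map_det]
  exact PadicInt.norm_le_one _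

theorem adj_int (n : ℕ) (z : MM p n) (hz : z ∈ OO p n) : z.adjugate ∈ OO p n := by
  intro i j
  rw [Matrix.adjugate_apply]
  apply det_int
  intro k l
  rw [Matrix.updateRow_apply]
  split_ifs
  · rw [Pi.single_apply]; split_ifs <;> simp
  · exact hz k l

theorem KK_inv (n : ℕ) : (KK p n)⁻¹ = KK p n := by
  have h : ∀ g ∈ KK p n, g⁻¹ ∈ KK p n := by
    rintro g ⟨h1, h2⟩
    refine ⟨?_, ?_⟩
    · intro i j
      rw [Matrix.coe_units_inv, Matrix.inv_def, Ring.inverse_eq_inv, Matrix.smul_apply, smul_eq_mul,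
        norm_mul, norm_inv, h2, inv_one, one_mul]
      exact adj_int n _ h1 i j
    · rw [Matrix.coe_units_inv, Matrix.det_nonsing_inv, Ring.inverse_eq_inv, norm_inv, h2, inv_one]
  ext g
  exact ⟨fun hg => by simpa using h _ hg, fun hg => h g hg⟩

theorem lam_KK (n : ℕ) (vol : Measure (MM p n)) [vol.IsAddHaarMeasure]
    (hnorm : vol (OO p n) = 1) : lam n vol (KK p n) ≠ 0 ∧ lam n vol (KK p n) ≠ ∞ := by
  set T : Set (MM p n) := OO p n ∩ {z | ‖z.det‖ = 1} with hT
  have ho : IsOpen T := by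
    refine (OO_open n).inter ?_
    have := (IsUltrametricDist.isOpen_sphere (0 : ℚ_[p]) one_ne_zero).preimage (det_cont n)
    simpa [Set.preimage, Metric.mem_sphere] using this
  have hne : T.Nonempty := by
    refine ⟨1, ?_, ?_⟩
    · intro i j
      rw [Matrix.one_apply]; split_ifs <;> simp
    · simp
  have e : lam n vol (KK p n) = vol T := by
    rw [lam, (val_emb n).comap_apply]
    have : Units.val '' (KK p n) = T := by
      ext z
      constructor
      · rintro ⟨g, hg, rfl⟩; exact hg
      · rintro ⟨h1, h2⟩
        obtain ⟨g, rfl⟩ : IsUnit z := by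
          rw [unit_iff]; intro h0; simp [h0] at h2
        exact ⟨g, ⟨h1, h2⟩, rfl⟩
    rw [this, nuM, withDensity_apply _ ho.measurableSet]
    rw [setLIntegral_congr_fun (g := fun _ => 1) ho.measurableSet, setLIntegral_one]
    rintro z ⟨_, hz⟩
    have hz' : ‖z.det‖₊ = 1 := by ext; simpa using hz
    simp [DD, hz']
  rw [e]
  refine ⟨(ho.measure_pos vol hne).ne', ne_top_of_le_ne_top ENNReal.one_ne_top ?_⟩
  exact (measure_mono Set.inter_subset_left).trans hnorm.le

theorem lam_sf (n : ℕ) (vol : Measure (MM p n)) [vol.IsAddHaarMeasure] :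
    SigmaFinite (lam n vol) := by
  have h1 : SigmaFinite (nuM n vol) :=
    SigmaFinite.withDensity (DD p n)
  have h2 : SigmaFinite (Measure.map Units.val (lam n vol)) := by
    rw [map_val_lam]; infer_instance
  exact SigmaFinite.of_map _ (val_emb n).measurable.aemeasurable h2

theorem lam_inv_eq (n : ℕ) (vol : Measure (MM p n)) [vol.IsAddHaarMeasure]
    (hnorm : vol (OO p n) = 1) : Measure.map (fun g => g⁻¹) (lam n vol) = lam n vol := by
  have := lam_left n vol hnorm
  have := lam_right n vol hnorm
  have := lam_sf n vol
  obtain ⟨h0, h1⟩ := lam_KK n vol hnorm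
  have h2 := measure_eq_div_smul (lam n vol).inv (lam n vol) h0 h1
  rw [Measure.inv_apply, KK_inv, ENNReal.div_self h0 h1, one_smul] at h2
  exact h2

theorem nu_map_inv (n : ℕ) (vol : Measure (MM p n)) [vol.IsAddHaarMeasure]
    (hnorm : vol (OO p n) = 1) :
    Measure.map (fun z : MM p n => z⁻¹) ((nuM n vol).restrict {z | IsUnit z}) =
      (nuM n vol).restrict {z | IsUnit z} := by
  rw [← map_val_lam, Measure.map_map (inv_meas n) (val_emb n).measurable]
  conv_rhs => rw [← lam_inv_eq n vol hnorm, Measure.map_map (val_emb n).measurable measurable_inv]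
  congr 1
  funext g
  simp

end helpers

/-- the pushforward of Haar measure under matrix inversion on
`GL(n, ℚ_p)` is `|det z|_p^{-2n} · vol`. -/
theorem map_inv_haar (n : ℕ) (vol : Measure (Matrix (Fin n) (Fin n) ℚ_[p]))
    [vol.IsAddHaarMeasure]
    (hnorm : vol {z : Matrix (Fin n) (Fin n) ℚ_[p] | ∀ i j, ‖z i j‖ ≤ 1} = 1) :
    Measure.map (fun z : Matrix (Fin n) (Fin n) ℚ_[p] => z⁻¹)
        (vol.restrict {z | IsUnit z}) =
      (vol.restrict {z | IsUnit z}).withDensity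
        (fun z => ENNReal.ofReal (‖z.det‖ ^ (-(2 * n : ℤ)))) := by
  have hN := N_meas (p := p) n
  have hI := inv_meas (p := p) n
  have hDm : Measurable (fun z : MM p n => (DD p n z : ℝ≥0∞)) := (DD_meas n).coe_nnreal_ennreal
  have hFm : Measurable (fun z : MM p n => (((DD p n z⁻¹)⁻¹ : ℝ≥0) : ℝ≥0∞)) :=
    ((DD_meas n).comp hI).inv.coe_nnreal_ennreal
  have hF'm : Measurable (fun z : MM p n => (((DD p n z)⁻¹ : ℝ≥0) : ℝ≥0∞)) :=
    (DD_meas n).inv.coe_nnreal_ennreal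
  have hnu : (nuM n vol).restrict {z | IsUnit z} =
      (vol.restrict {z | IsUnit z}).withDensity (fun z => (DD p n z : ℝ≥0∞)) :=
    restrict_withDensity hN _
  have hD0 : ∀ z : MM p n, IsUnit z → DD p n z ≠ 0 := by
    intro z hz
    rw [unit_iff] at hz
    exact zpow_ne_zero _ (by simpa using hz)
  have hvol : vol.restrict {z | IsUnit z} = ((nuM n vol).restrict {z | IsUnit z}).withDensity
      (fun z => (((DD p n z)⁻¹ : ℝ≥0) : ℝ≥0∞)) := by
    rw [hnu, ← withDensity_mul _ hDm hF'm]
    conv_lhs => rw [← withDensity_one (μ := vol.restrict {z : MM p n | IsUnit z})]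
    refine withDensity_congr_ae ?_
    filter_upwards [ae_restrict_mem hN] with z hz
    rw [Pi.mul_apply, ← ENNReal.coe_mul, mul_inv_cancel₀ (hD0 z hz)]
    rfl
  have hmain : Measure.map (fun z : MM p n => z⁻¹) (vol.restrict {z | IsUnit z}) =
      ((nuM n vol).restrict {z | IsUnit z}).withDensity
        (fun z => (((DD p n z⁻¹)⁻¹ : ℝ≥0) : ℝ≥0∞)) := by
    ext s hs
    rw [Measure.map_apply hI hs, withDensity_apply _ hs]
    conv_rhs => rw [← nu_map_inv n vol hnorm, setLIntegral_map hs hFm hI]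
    conv_lhs => rw [hvol, withDensity_apply _ (hI hs)]
    refine lintegral_congr_ae (ae_restrict_of_ae ?_)
    filter_upwards [ae_restrict_mem hN] with z hz
    rw [Matrix.nonsing_inv_nonsing_inv _ ((Matrix.isUnit_iff_isUnit_det _).1 hz)]
  rw [hmain, hnu, ← withDensity_mul _ hDm hFm]
  refine withDensity_congr_ae ?_
  filter_upwards [ae_restrict_mem hN] with z hz
  have hz' : ‖z.det‖ ≠ 0 := by simpa using (unit_iff n z).1 hz
  rw [Pi.mul_apply, ← ENNReal.coe_mul, ← ENNReal.ofReal_coe_nnreal]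
  congr 1
  simp only [DD, Matrix.det_nonsing_inv, Ring.inverse_eq_inv]
  push_cast
  rw [norm_inv, _root_.inv_zpow, inv_inv, ← zpow_add₀ hz']
  congr 1
  ring
end

section
/- For every α > 2n - 1, the integral ∫_{Mat(n, Q_p)} γ(z)^{-α} d vol(z) converges and equals ∏_{j=1}^n (1 - p^{-α + n - j}) / (1 - p^{-α + n + j - 1}). -/
open MeasureTheory Matrix
open scoped ENNReal NNReal BigOperators

variable {p : ℕ} [Fact p.Prime]

namespace Hua

section scale
variable {E : Type*} [NormedAddCommGroup E] [MeasurableSpace E] [BorelSpace E]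
  [LocallyCompactSpace E] [SecondCountableTopology E]

lemma eq_of_unit (μ ν : Measure E) [μ.IsAddHaarMeasure] [ν.IsAddHaarMeasure]
    (Z : Set E) (hZ : μ Z = 1) : ν = (ν Z) • μ := by
  have h := Measure.isAddLeftInvariant_eq_smul ν μ
  have h2 : ν Z = (Measure.addHaarScalarFactor ν μ : ℝ≥0∞) := by
    conv_lhs => rw [h]
    rw [Measure.smul_apply, hZ]; simp [ENNReal.smul_def]
  rw [h2]
  exact h

variable [NormedSpace ℚ_[p] E]

lemma map_symm_eq (μ : Measure E) [μ.IsAddHaarMeasure] (Z : Set E) (hZ : μ Z = 1)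
    (T : E ≃L[ℚ_[p]] E) : μ.map T.symm = (μ (T '' Z)) • μ := by
  have hH : (μ.map T.symm).IsAddHaarMeasure :=
    T.symm.toLinearEquiv.toAddEquiv.isAddHaarMeasure_map μ T.symm.continuous T.continuous
  have h := eq_of_unit μ (μ.map T.symm) Z hZ
  have e := T.symm.toHomeomorph.toMeasurableEquiv.map_apply (μ := μ) Z
  have e2 : (μ.map T.symm) Z = μ (T '' Z) := by
    refine e.trans ?_
    congr 1
    exact (T.image_eq_preimage_symm Z).symm
  rw [← e2]; exact h

lemma scale_set (μ : Measure E) [μ.IsAddHaarMeasure] (Z : Set E) (hZ : μ Z = 1)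
    (T : E ≃L[ℚ_[p]] E) (S : Set E) : μ (T '' S) = μ (T '' Z) * μ S := by
  have h := map_symm_eq μ Z hZ T
  have e := T.symm.toHomeomorph.toMeasurableEquiv.map_apply (μ := μ) S
  have e2 : (μ.map T.symm) S = μ (T '' S) := by
    refine e.trans ?_
    congr 1
    exact (T.image_eq_preimage_symm S).symm
  rw [← e2, h]; simp

lemma scale_lintegral (μ : Measure E) [μ.IsAddHaarMeasure] (Z : Set E) (hZ : μ Z = 1)
    (T : E ≃L[ℚ_[p]] E) (f : E → ℝ≥0∞) :
    ∫⁻ x, f (T.symm x) ∂μ = μ (T '' Z) * ∫⁻ x, f x ∂μ := by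
  have h := map_symm_eq μ Z hZ T
  have e := MeasureTheory.lintegral_map_equiv (μ := μ) f T.symm.toHomeomorph.toMeasurableEquiv
  refine e.symm.trans ?_
  have : (μ.map T.symm.toHomeomorph.toMeasurableEquiv) = μ.map T.symm := rfl
  rw [this, h]; simp
end scale

/-- Unit ball of `ℚ_p` as a positive compact. -/
noncomputable def unitPC (p : ℕ) [Fact p.Prime] : TopologicalSpace.PositiveCompacts ℚ_[p] where
  carrier := Metric.closedBall 0 1
  isCompact' := isCompact_closedBall _ _
  interior_nonempty' := ⟨0, by
    rw [mem_interior_iff_mem_nhds]; exact Metric.closedBall_mem_nhds _ one_pos⟩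

/-- Normalized Haar measure on `ℚ_p`. -/
noncomputable def mu1 (p : ℕ) [Fact p.Prime] : Measure ℚ_[p] := Measure.addHaarMeasure (unitPC p)

instance : (mu1 p).IsAddHaarMeasure := by unfold mu1; infer_instance

lemma mu1_unit : mu1 p (Metric.closedBall 0 1) = 1 := Measure.addHaarMeasure_self (K₀ := unitPC p)

lemma p_pos : (0:ℝ) < p := by exact_mod_cast (Fact.out : p.Prime).pos
lemma p_gt : (1:ℝ) < p := by exact_mod_cast (Fact.out : p.Prime).one_lt
lemma pQ_ne : (p : ℚ_[p]) ≠ 0 := by exact_mod_cast (Fact.out : p.Prime).ne_zero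

lemma lt_one_iff (x : ℚ_[p]) : ‖x‖ < 1 ↔ ‖x‖ ≤ (p:ℝ)⁻¹ := by
  have := Padic.norm_le_pow_iff_norm_lt_pow_add_one x (-1)
  simpa using this.symm

lemma unit_cover : Metric.closedBall (0:ℚ_[p]) 1 =
    ⋃ i ∈ Finset.range p, (fun x => (i : ℚ_[p]) + x) '' Metric.closedBall 0 (p:ℝ)⁻¹ := by
  ext x
  simp only [Set.mem_iUnion, Set.mem_image, Metric.mem_closedBall, dist_zero_right,
    Finset.mem_range]
  constructor
  · intro hx
    obtain ⟨X, hX⟩ : ∃ X : ℤ_[p], (X : ℚ_[p]) = x := ⟨⟨x, hx⟩, rfl⟩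
    obtain ⟨n, hn, h⟩ := PadicInt.exists_mem_range X
    refine ⟨n, hn, x - n, ?_, by ring⟩
    rw [← lt_one_iff]
    have h' : ‖X - (n:ℤ_[p])‖ < 1 := PadicInt.mem_nonunits.1 h
    rw [PadicInt.norm_def, PadicInt.coe_sub, PadicInt.coe_natCast, hX] at h'
    exact h'
  · rintro ⟨i, hi, y, hy, rfl⟩
    refine (Padic.nonarchimedean _ _).trans (max_le ?_ (((lt_one_iff y).2 hy).le))
    exact_mod_cast Padic.norm_int_le_one (p := p) i

lemma mu1_p : (p : ℝ≥0∞) * mu1 p (Metric.closedBall 0 (p:ℝ)⁻¹) = 1 := by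
  have h := mu1_unit (p := p)
  rw [unit_cover, measure_biUnion_finset] at h
  · simp only [measure_preimage_add, Set.image_add_left] at h
    simpa using h
  · intro i hi j hj hij
    simp only [Function.onFun]
    rw [Set.disjoint_left]
    rintro _ ⟨x, hx, rfl⟩ ⟨y, hy, hxy⟩
    simp only [Metric.mem_closedBall, dist_zero_right] at hx hy
    rw [← lt_one_iff] at hx hy
    simp only at hxy
    have h1 : ((i - j : ℤ) : ℚ_[p]) = y - x := by push_cast; linear_combination -hxy
    have h2 : ‖((i - j : ℤ) : ℚ_[p])‖ < 1 := by
      rw [h1, sub_eq_add_neg]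
      exact (Padic.nonarchimedean _ _).trans_lt (max_lt hy (by simpa using hx))
    rw [Padic.norm_intCast_lt_one_iff] at h2
    simp only [Finset.coe_range, Set.mem_Iio] at hi hj
    apply hij
    have := Int.eq_zero_of_abs_lt_dvd h2 (by rw [abs_lt]; omega)
    omega
  · intro i _
    rw [Set.image_add_left]
    exact (measurable_const_add _) Metric.isClosed_closedBall.measurableSet

lemma smul_image_ball (c : ℚ_[p]) (hc : c ≠ 0) (r : ℝ) :
    (fun x => c * x) '' Metric.closedBall 0 r = Metric.closedBall 0 (‖c‖ * r) := by
  ext x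
  simp only [Set.mem_image, Metric.mem_closedBall, dist_zero_right]
  constructor
  · rintro ⟨y, hy, rfl⟩
    rw [norm_mul]; gcongr
  · intro h
    refine ⟨c⁻¹ * x, ?_, by field_simp⟩
    rw [norm_mul, norm_inv, inv_mul_le_iff₀ (norm_pos_iff.2 hc)]
    exact h

/-- multiplication by a nonzero scalar -/
noncomputable def mulE (c : ℚ_[p]) (hc : c ≠ 0) : ℚ_[p] ≃L[ℚ_[p]] ℚ_[p] :=
  ContinuousLinearEquiv.smulLeft (Units.mk0 c hc)

lemma mulE_apply (c : ℚ_[p]) (hc : c ≠ 0) (x) : mulE c hc x = c * x := rfl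

lemma mu1_pow (k : ℕ) : mu1 p (Metric.closedBall 0 ((p:ℝ) ^ k)) = (p:ℝ≥0∞) ^ k := by
  induction k with
  | zero => simpa using mu1_unit
  | succ k ih =>
    have h := scale_set (mu1 p) (Metric.closedBall 0 1) mu1_unit (mulE (p:ℚ_[p]) pQ_ne)
      (Metric.closedBall 0 ((p:ℝ) ^ (k+1)))
    have e : ∀ r, (mulE (p:ℚ_[p]) pQ_ne) '' Metric.closedBall 0 r
        = Metric.closedBall 0 ((p:ℝ)⁻¹ * r) := by
      intro r
      have := smul_image_ball (p:ℚ_[p]) pQ_ne r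
      rw [Padic.norm_p] at this
      exact this
    rw [e, e] at h
    have : (p:ℝ)⁻¹ * p ^ (k+1) = p ^ k := by have := p_pos (p := p); field_simp; ring
    rw [this, ih, mul_one] at h
    rw [pow_succ' (p:ℝ≥0∞), h, ← mul_assoc, mu1_p, one_mul]

lemma exists_pow (x : ℚ_[p]) : ∃ k : ℕ, max ‖x‖ 1 = (p:ℝ)^k := by
  by_cases hx : ‖x‖ ≤ 1
  · exact ⟨0, by simpa using hx⟩
  · push Not at hx
    have hx0 : x ≠ 0 := by rintro rfl; simp at hx; linarith
    obtain ⟨n, hn⟩ := (⟨-x.valuation, Padic.norm_eq_zpow_neg_valuation hx0⟩ : ∃ n : ℤ, ‖x‖ = (p:ℝ)^n)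
    have : 0 ≤ n := by
      by_contra h
      push Not at h
      have := zpow_lt_one_of_neg₀ (p_gt (p := p)) h
      linarith
    lift n to ℕ using this
    refine ⟨n, ?_⟩
    rw [max_eq_left hx.le, hn]; simp

lemma mu1_max (x : ℚ_[p]) :
    mu1 p (Metric.closedBall 0 (max ‖x‖ 1)) = ENNReal.ofReal (max ‖x‖ 1) := by
  obtain ⟨k, hk⟩ := exists_pow x
  rw [hk, mu1_pow, ENNReal.ofReal_pow p_pos.le, ENNReal.ofReal_natCast]

/-- Normalized Haar measure on `ℚ_p^n`. -/
noncomputable def mu (p : ℕ) [Fact p.Prime] (n : ℕ) : Measure (Fin n → ℚ_[p]) :=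
  Measure.pi fun _ => mu1 p

instance (n : ℕ) : (mu p n).IsAddHaarMeasure := by unfold mu; infer_instance
instance (n : ℕ) : SigmaFinite (mu p n) := by unfold mu; infer_instance

/-- The integral vectors. -/
def Oset (p : ℕ) [Fact p.Prime] (n : ℕ) : Set (Fin n → ℚ_[p]) := {a | ∀ i, ‖a i‖ ≤ 1}

/-- Box with side given by `max ‖d j‖ 1`. -/
def Box {n : ℕ} (d : Fin n → ℚ_[p]) : Set (Fin n → ℚ_[p]) := {a | ∀ i, ‖a i‖ ≤ max ‖d i‖ 1}

lemma mu_Box {n : ℕ} (d : Fin n → ℚ_[p]) :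
    mu p n (Box d) = ∏ i, ENNReal.ofReal (max ‖d i‖ 1) := by
  have : Box d = Set.pi Set.univ fun i => Metric.closedBall 0 (max ‖d i‖ 1) := by
    ext x; simp only [Box, Set.mem_ofPred_eq, Set.mem_pi, Set.mem_univ, true_imp_iff,
      Metric.mem_closedBall, dist_zero_right]
  rw [this, mu, Measure.pi_pi]
  simp only [mu1_max]

lemma mu_O (n : ℕ) : mu p n (Oset p n) = 1 := by
  have : Oset p n = Box (0 : Fin n → ℚ_[p]) := by
    ext x; simp [Oset, Box]
  rw [this, mu_Box]; simp

lemma mu_ball (n k : ℕ) : mu p n (Metric.closedBall 0 ((p:ℝ)^k)) = ((p:ℝ≥0∞) ^ k) ^ n := by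
  rw [closedBall_pi _ (by have := p_pos (p := p); positivity), mu, Measure.pi_pi]
  simp [mu1_pow]

/-- Lattice generated by integral vectors and the vectors `c j`. -/
def Lat {n m : ℕ} (c : Fin m → Fin n → ℚ_[p]) : Set (Fin n → ℚ_[p]) :=
  {x | ∃ a ∈ Oset p n, ∃ b ∈ Oset p m, x = a + ∑ j, b j • c j}

/-- Lattice generated by integral vectors and one vector. -/
def Lat1 {n : ℕ} (w : Fin n → ℚ_[p]) : Set (Fin n → ℚ_[p]) :=
  {x | ∃ a ∈ Oset p n, ∃ b : ℚ_[p], ‖b‖ ≤ 1 ∧ x = a + b • w}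

lemma norm_add_le' {x y : ℚ_[p]} {r : ℝ} (hx : ‖x‖ ≤ r) (hy : ‖y‖ ≤ r) : ‖x + y‖ ≤ r :=
  (Padic.nonarchimedean _ _).trans (max_le hx hy)

lemma norm_sub_le' {x y : ℚ_[p]} {r : ℝ} (hx : ‖x‖ ≤ r) (hy : ‖y‖ ≤ r) : ‖x - y‖ ≤ r := by
  rw [sub_eq_add_neg]; exact norm_add_le' hx (by simpa using hy)

lemma norm_mul_le' {x y : ℚ_[p]} (hx : ‖x‖ ≤ 1) (hy : ‖y‖ ≤ 1) : ‖x * y‖ ≤ 1 := by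
  rw [norm_mul]; exact mul_le_one₀ hx (norm_nonneg _) hy

lemma norm_sum_le' {ι : Type*} (s : Finset ι) (f : ι → ℚ_[p]) (h : ∀ i ∈ s, ‖f i‖ ≤ 1) :
    ‖∑ i ∈ s, f i‖ ≤ 1 := by
  classical
  induction s using Finset.induction_on with
  | empty => simp
  | insert a s ha ih =>
    rw [Finset.sum_insert ha]
    exact norm_add_le' (h _ (by simp)) (ih fun i hi => h i (by simp [hi]))

lemma O_add {n : ℕ} {a b : Fin n → ℚ_[p]} (ha : a ∈ Oset p n) (hb : b ∈ Oset p n) :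
    a + b ∈ Oset p n := fun i => norm_add_le' (ha i) (hb i)

lemma O_smul {n : ℕ} {a : Fin n → ℚ_[p]} {c : ℚ_[p]} (ha : a ∈ Oset p n) (hc : ‖c‖ ≤ 1) :
    c • a ∈ Oset p n := fun i => norm_mul_le' hc (ha i)

lemma O_zero {n : ℕ} : (0 : Fin n → ℚ_[p]) ∈ Oset p n := fun i => by simp

lemma O_sum {n : ℕ} {ι : Type*} (s : Finset ι) (f : ι → Fin n → ℚ_[p])
    (h : ∀ i ∈ s, f i ∈ Oset p n) : ∑ i ∈ s, f i ∈ Oset p n := by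
  intro j
  rw [Finset.sum_apply]
  exact norm_sum_le' s _ fun i hi => h i hi j

/-- coordinate scaling -/
noncomputable def diagE {n : ℕ} (d : Fin n → ℚ_[p]) (hd : ∀ i, d i ≠ 0) :
    (Fin n → ℚ_[p]) ≃L[ℚ_[p]] (Fin n → ℚ_[p]) :=
  LinearEquiv.toContinuousLinearEquiv
  { toFun := fun x i => d i * x i
    invFun := fun x i => (d i)⁻¹ * x i
    map_add' := fun x y => by ext i; simp [mul_add]
    map_smul' := fun c x => by ext i; simp; ring
    left_inv := fun x => by ext i; simp [hd i]
    right_inv := fun x => by ext i; simp [hd i] }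

/-- shear in direction `u` along coordinate `i`, `u i = 0`. -/
noncomputable def shearE {n : ℕ} (i : Fin n) (u : Fin n → ℚ_[p]) (hu : u i = 0) :
    (Fin n → ℚ_[p]) ≃L[ℚ_[p]] (Fin n → ℚ_[p]) :=
  LinearEquiv.toContinuousLinearEquiv
  { toFun := fun x => x + x i • u
    invFun := fun x => x - x i • u
    map_add' := fun x y => by ext j; simp; ring
    map_smul' := fun c x => by ext j; simp; ring
    left_inv := fun x => by ext j; simp [hu]
    right_inv := fun x => by ext j; simp [hu] }

lemma diagE_apply {n : ℕ} (d : Fin n → ℚ_[p]) (hd) (x) (i) : diagE d hd x i = d i * x i := rfl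
lemma shearE_apply {n : ℕ} (i : Fin n) (u : Fin n → ℚ_[p]) (hu) (x) :
  shearE i u hu x = x + x i • u := rfl

lemma shear_O {n : ℕ} (i : Fin n) (u : Fin n → ℚ_[p]) (hu : u i = 0) (hO : u ∈ Oset p n) :
    shearE i u hu '' Oset p n = Oset p n := by
  apply Set.Subset.antisymm
  · rintro _ ⟨x, hx, rfl⟩
    rw [shearE_apply]
    exact O_add hx (O_smul hO (hx i))
  · intro x hx
    refine ⟨x + (- x i) • u, O_add hx (O_smul hO (by simpa using hx i)), ?_⟩
    rw [shearE_apply]; ext j; simp [hu]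

lemma coe_trans' {n : ℕ} (M T : (Fin n → ℚ_[p]) ≃L[ℚ_[p]] (Fin n → ℚ_[p])) :
    ⇑(M.trans T) = T ∘ M := rfl

lemma Lat1_spec {n : ℕ} (w : Fin n → ℚ_[p]) :
    ∃ M : (Fin n → ℚ_[p]) ≃L[ℚ_[p]] (Fin n → ℚ_[p]), M '' Oset p n = Lat1 w ∧
      mu p n (Lat1 w) = ENNReal.ofReal (max ‖w‖ 1) := by
  by_cases hw : ‖w‖ ≤ 1
  · have hwO : w ∈ Oset p n := fun i => (norm_le_pi_norm w i).trans hw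
    have : Lat1 w = Oset p n := by
      apply Set.Subset.antisymm
      · rintro _ ⟨a, ha, b, hb, rfl⟩
        exact O_add ha (O_smul hwO hb)
      · intro a ha
        exact ⟨a, ha, 0, by simp, by simp⟩
    refine ⟨ContinuousLinearEquiv.refl _ _, ?_, ?_⟩
    · rw [this]; simp
    · rw [this, mu_O, max_eq_right hw]; simp
  · push Not at hw
    obtain ⟨i, hi⟩ : ∃ i, ‖w i‖ = ‖w‖ := by
      have hne : Nonempty (Fin n) := by
        by_contra h
        rw [not_nonempty_iff] at h
        have : w = 0 := Subsingleton.elim _ _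
        rw [this] at hw; simp at hw; linarith
      obtain ⟨i, hi⟩ := Finite.exists_max (fun i => ‖w i‖)
      refine ⟨i, le_antisymm (norm_le_pi_norm w i) ?_⟩
      exact (pi_norm_le_iff_of_nonneg (norm_nonneg _)).2 hi
    have hwi : w i ≠ 0 := by
      intro h; rw [h] at hi; simp at hi; rw [← hi] at hw; linarith
    have hwi1 : ‖(w i)⁻¹‖ ≤ 1 := by
      rw [norm_inv, hi]; exact inv_le_one_of_one_le₀ hw.le
    have hrat : ∀ j, ‖w j * (w i)⁻¹‖ ≤ 1 := by
      intro j
      rw [norm_mul, norm_inv, hi, ← div_eq_mul_inv]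
      exact div_le_one_of_le₀ (norm_le_pi_norm w j) (norm_nonneg _)
    set d : Fin n → ℚ_[p] := Function.update 1 i (w i) with hd
    have hd0 : ∀ j, d j ≠ 0 := by
      intro j
      by_cases h : j = i
      · subst h; simpa [hd] using hwi
      · simp [hd, h]
    set u : Fin n → ℚ_[p] := Function.update (fun j => w j * (w i)⁻¹) i 0 with hu
    have hui : u i = 0 := by simp [hu]
    have huO : u ∈ Oset p n := by
      intro j
      by_cases h : j = i
      · subst h; simp [hu]
      · simpa [hu, h] using hrat j
    have hM : ((diagE d hd0).trans (shearE i u hui)) '' Oset p n = Lat1 w := by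
      apply Set.Subset.antisymm
      · rintro _ ⟨x, hx, rfl⟩
        refine ⟨Function.update x i 0, ?_, x i, hx i, ?_⟩
        · intro j
          by_cases h : j = i
          · subst h; simp
          · simpa [h] using hx j
        · ext j
          simp only [ContinuousLinearEquiv.trans_apply, shearE_apply, Pi.add_apply, diagE_apply,
            Pi.smul_apply, smul_eq_mul]
          by_cases h : j = i
          · subst h; simp [hd, hu]; ring
          · simp [hd, hu, h]; field_simp
      · rintro _ ⟨a, ha, b, hb, rfl⟩
        refine ⟨Function.update (fun j => a j - a i * (w j * (w i)⁻¹)) i (a i * (w i)⁻¹ + b),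
          ?_, ?_⟩
        · intro j
          by_cases h : j = i
          · subst h; simpa using norm_add_le' (norm_mul_le' (ha j) hwi1) hb
          · simpa [h] using norm_sub_le' (ha j) (norm_mul_le' (ha i) (hrat j))
        · ext j
          simp only [ContinuousLinearEquiv.trans_apply, shearE_apply, Pi.add_apply, diagE_apply,
            Pi.smul_apply, smul_eq_mul]
          by_cases h : j = i
          · subst h; simp [hd, hu]; field_simp
          · simp [hd, hu, h]; field_simp; ring
    refine ⟨_, hM, ?_⟩
    have hB : diagE d hd0 '' Oset p n = Box d := by
      have hdn : ∀ j, max ‖d j‖ 1 = ‖d j‖ := by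
        intro j
        apply max_eq_left
        by_cases h : j = i
        · subst h; simp [hd, hi, hw.le]
        · simp [hd, h]
      apply Set.Subset.antisymm
      · rintro _ ⟨x, hx, rfl⟩ j
        rw [diagE_apply, hdn, norm_mul]
        exact mul_le_of_le_one_right (norm_nonneg _) (hx j)
      · intro x hx
        refine ⟨fun j => (d j)⁻¹ * x j, ?_, ?_⟩
        · intro j
          have := hx j
          rw [hdn] at this
          rw [norm_mul, norm_inv, inv_mul_le_iff₀ (norm_pos_iff.2 (hd0 j)), mul_one]
          exact this
        · ext j; rw [diagE_apply]; simp [hd0 j]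
    rw [← hM, coe_trans', Set.image_comp, hB,
      scale_set (mu p n) (Oset p n) (mu_O n), shear_O i u hui huO, mu_O, one_mul, mu_Box,
      Finset.prod_eq_single i]
    · simp [hd, hi]
    · intro j _ hj; simp [hd, hj]
    · simp

lemma Lat_cons {n m : ℕ} (w : Fin n → ℚ_[p]) (c : Fin m → Fin n → ℚ_[p])
    (T : (Fin n → ℚ_[p]) ≃L[ℚ_[p]] (Fin n → ℚ_[p])) (hT : T '' Oset p n = Lat c) :
    Lat (Fin.cons w c : Fin (m+1) → Fin n → ℚ_[p]) = T '' Lat1 (T.symm w) := by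
  apply Set.Subset.antisymm
  · rintro _ ⟨a, ha, b, hb, rfl⟩
    have : a + ∑ j, b j.succ • c j ∈ Lat c := ⟨a, ha, fun j => b j.succ, fun j => hb _, rfl⟩
    rw [← hT] at this
    obtain ⟨x, hx, hx2⟩ := this
    refine ⟨x + b 0 • T.symm w, ⟨x, hx, b 0, hb 0, rfl⟩, ?_⟩
    rw [map_add, hx2, Fin.sum_univ_succ]; simp
    abel
  · rintro _ ⟨_, ⟨x, hx, b0, hb0, rfl⟩, rfl⟩
    have : T x ∈ Lat c := by rw [← hT]; exact ⟨x, hx, rfl⟩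
    obtain ⟨a, ha, b, hb, h⟩ := this
    refine ⟨a, ha, (Fin.cons b0 b : Fin (m+1) → ℚ_[p]), ?_, ?_⟩
    · intro j
      refine Fin.cases ?_ (fun j => ?_) j
      · simpa using hb0
      · simpa using hb j
    · rw [map_add, h, Fin.sum_univ_succ]; simp
      abel

lemma Lat_spec {n : ℕ} : ∀ {m : ℕ} (c : Fin m → Fin n → ℚ_[p]),
    ∃ T : (Fin n → ℚ_[p]) ≃L[ℚ_[p]] (Fin n → ℚ_[p]), T '' Oset p n = Lat c := by
  intro m
  induction m with
  | zero =>
    intro c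
    refine ⟨ContinuousLinearEquiv.refl _ _, ?_⟩
    ext x
    simp [Lat, Oset]
  | succ m ih =>
    intro c
    rw [← Fin.cons_self_tail c]
    obtain ⟨T, hT⟩ := ih (Fin.tail c)
    obtain ⟨M, hM, -⟩ := Lat1_spec (T.symm (c 0))
    refine ⟨M.trans T, ?_⟩
    rw [Lat_cons _ _ T hT, ← hM, coe_trans', Set.image_comp]

/-- The lattice volume. -/
noncomputable def Gam {n m : ℕ} (c : Fin m → Fin n → ℚ_[p]) : ℝ≥0∞ := mu p n (Lat c)

lemma Gam_cons {n m : ℕ} (w : Fin n → ℚ_[p]) (c : Fin m → Fin n → ℚ_[p])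
    (T : (Fin n → ℚ_[p]) ≃L[ℚ_[p]] (Fin n → ℚ_[p])) (hT : T '' Oset p n = Lat c) :
    Gam (Fin.cons w c : Fin (m+1) → Fin n → ℚ_[p])
      = Gam c * ENNReal.ofReal (max ‖T.symm w‖ 1) := by
  obtain ⟨M, hM, h⟩ := Lat1_spec (T.symm w)
  rw [Gam, Lat_cons w c T hT, scale_set (mu p n) (Oset p n) (mu_O n), hT, h, Gam]

lemma Lat_invariant {n m : ℕ} (c c' : Fin m → Fin n → ℚ_[p]) (h : ∀ j, c' j - c j ∈ Oset p n) :
    Lat c' ⊆ Lat c := by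
  rintro _ ⟨a, ha, b, hb, rfl⟩
  refine ⟨a + ∑ j, b j • (c' j - c j), O_add ha (O_sum _ _ fun j _ => O_smul (h j) (hb j)), b, hb, ?_⟩
  rw [add_assoc, ← Finset.sum_add_distrib]
  congr 2
  ext j; simp [smul_sub]

lemma Gam_continuous {n m : ℕ} : Continuous (Gam : (Fin m → Fin n → ℚ_[p]) → ℝ≥0∞) := by
  apply IsLocallyConstant.continuous
  rw [IsLocallyConstant.iff_eventually_eq]
  intro c
  filter_upwards [Metric.closedBall_mem_nhds c one_pos] with c' hc'
  rw [Metric.mem_closedBall, dist_eq_norm] at hc'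
  have h1 : ∀ j, c' j - c j ∈ Oset p n := fun j i =>
    ((norm_le_pi_norm ((c' - c) j) i).trans (norm_le_pi_norm (c' - c) j)).trans hc'
  have h2 : ∀ j, c j - c' j ∈ Oset p n := fun j i => by
    have := h1 j i
    rw [Pi.sub_apply, norm_sub_rev] at this
    exact this
  unfold Gam
  rw [Set.Subset.antisymm (Lat_invariant c c' h1) (Lat_invariant c' c h2)]

lemma Gam_ge {n m : ℕ} (c : Fin m → Fin n → ℚ_[p]) : 1 ≤ Gam c := by
  rw [← mu_O (p := p) n]
  apply measure_mono
  intro a ha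
  exact ⟨a, ha, 0, O_zero, by simp⟩

lemma Gam_ne_top {n : ℕ} : ∀ {m : ℕ} (c : Fin m → Fin n → ℚ_[p]), Gam c ≠ ∞ := by
  intro m
  induction m with
  | zero =>
    intro c
    have : Gam c = 1 := by
      rw [Gam, ← mu_O (p := p) n]; congr 1
      ext x; simp [Lat, Oset]
    simp [this]
  | succ m ih =>
    intro c
    rw [← Fin.cons_self_tail c]
    obtain ⟨T, hT⟩ := Lat_spec (Fin.tail c)
    rw [Gam_cons _ _ T hT]
    exact ENNReal.mul_ne_top (ih _) ENNReal.ofReal_ne_top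

/-- one-column integral -/
noncomputable def J (p : ℕ) [Fact p.Prime] (n : ℕ) (α : ℝ) : ℝ≥0∞ :=
  ∫⁻ w, (ENNReal.ofReal (max ‖w‖ 1)) ^ (-α) ∂(mu p n)

/-- multi-column integral -/
noncomputable def I (p : ℕ) [Fact p.Prime] (n m : ℕ) (α : ℝ) : ℝ≥0∞ :=
  ∫⁻ c : Fin m → Fin n → ℚ_[p], (Gam c) ^ (-α) ∂(Measure.pi fun _ => mu p n)

lemma I_succ (n m : ℕ) (α : ℝ) : I p n (m+1) α = I p n m (α - 1) * J p n α := by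
  have h := (measurePreserving_piFinSuccAbove (fun _ : Fin (m+1) => mu p n) 0).symm
  rw [I, ← h.lintegral_comp_emb (MeasurableEquiv.measurableEmbedding _)]
  have hmeas : Measurable fun x : (Fin n → ℚ_[p]) × (Fin m → Fin n → ℚ_[p]) =>
      Gam ((MeasurableEquiv.piFinSuccAbove (fun _ : Fin (m+1) => Fin n → ℚ_[p]) 0).symm x)
        ^ (-α) := by
    have : Measurable (Gam : (Fin (m+1) → Fin n → ℚ_[p]) → ℝ≥0∞) := Gam_continuous.measurable
    exact (this.comp (MeasurableEquiv.measurable _)).pow_const _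
  rw [lintegral_prod_symm _ hmeas.aemeasurable]
  have hin : ∀ c : Fin m → Fin n → ℚ_[p],
      ∫⁻ w, Gam ((MeasurableEquiv.piFinSuccAbove (fun _ : Fin (m+1) => Fin n → ℚ_[p]) 0).symm
        (w, c)) ^ (-α) ∂(mu p n) = Gam c ^ (-(α - 1)) * J p n α := by
    intro c
    obtain ⟨T, hT⟩ := Lat_spec c
    have e : ∀ w, (MeasurableEquiv.piFinSuccAbove (fun _ : Fin (m+1) => Fin n → ℚ_[p]) 0).symm
        (w, c) = (Fin.cons w c : Fin (m+1) → Fin n → ℚ_[p]) := by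
      intro w
      simp [MeasurableEquiv.piFinSuccAbove_symm_apply, Fin.insertNthEquiv]
    have h0 : Gam c ≠ 0 := (lt_of_lt_of_le one_pos (Gam_ge c)).ne'
    have e2 : ∀ w, Gam ((MeasurableEquiv.piFinSuccAbove
        (fun _ : Fin (m+1) => Fin n → ℚ_[p]) 0).symm (w, c)) ^ (-α)
        = Gam c ^ (-α) * (ENNReal.ofReal (max ‖T.symm w‖ 1)) ^ (-α) := by
      intro w
      rw [e, Gam_cons w c T hT, ENNReal.mul_rpow_of_ne_top (Gam_ne_top c) ENNReal.ofReal_ne_top]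
    simp only [e2]
    rw [lintegral_const_mul' _ _ (ENNReal.rpow_ne_top_of_ne_zero h0 (Gam_ne_top c)),
      scale_lintegral (mu p n) (Oset p n) (mu_O n) T
        (fun w => (ENNReal.ofReal (max ‖w‖ 1)) ^ (-α)), hT]
    have : Gam c ^ (-(α - 1)) = Gam c ^ (-α) * Gam c := by
      have := ENNReal.rpow_add (-α) 1 h0 (Gam_ne_top c)
      rw [ENNReal.rpow_one] at this
      rw [← this]; congr 1; ring
    rw [this, J, mul_assoc]; rfl
  simp only [hin]
  rw [lintegral_mul_const _ (Gam_continuous.measurable.pow_const _), I]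

lemma I_zero (n : ℕ) (α : ℝ) : I p n 0 α = 1 := by
  have : ∀ c : Fin 0 → Fin n → ℚ_[p], Gam c = 1 := by
    intro c
    rw [Gam, ← mu_O (p := p) n]; congr 1
    ext x; simp [Lat, Oset]
  simp only [I, this]
  simp

lemma I_eq (n m : ℕ) : ∀ α : ℝ, I p n m α = ∏ i ∈ Finset.range m, J p n (α - i) := by
  induction m with
  | zero => intro α; simp [I_zero]
  | succ m ih =>
    intro α
    rw [I_succ, ih, Finset.prod_range_succ']
    simp only [Nat.cast_add, Nat.cast_one, Nat.cast_zero, sub_zero]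
    congr 1
    apply Finset.prod_congr rfl
    intro i _
    congr 1; ring

lemma tsum_geom (a r : ℝ) (ha : 0 ≤ a) (hr : 0 ≤ r) (hr1 : r < 1) :
    ∑' k : ℕ, ENNReal.ofReal (a * r ^ k) = ENNReal.ofReal (a / (1 - r)) := by
  have hs := (hasSum_geometric_of_lt_one hr hr1).mul_left a
  rw [← ENNReal.ofReal_tsum_of_nonneg (fun k => by positivity) hs.summable, hs.tsum_eq]
  rfl

lemma exists_pow_vec {n : ℕ} (w : Fin n → ℚ_[p]) : ∃ k : ℕ, max ‖w‖ 1 = (p:ℝ)^k := by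
  by_cases hne : Nonempty (Fin n)
  · obtain ⟨i, hi⟩ := Finite.exists_max (fun i => ‖w i‖)
    have : ‖w i‖ = ‖w‖ := le_antisymm (norm_le_pi_norm w i)
      ((pi_norm_le_iff_of_nonneg (norm_nonneg _)).2 hi)
    rw [← this]; exact exists_pow _
  · rw [not_nonempty_iff] at hne
    have : w = 0 := Subsingleton.elim _ _
    exact ⟨0, by simp [this]⟩

lemma pow_identity {n : ℕ} (α : ℝ) (hα : 0 < α) (w : Fin n → ℚ_[p]) :
    (ENNReal.ofReal (max ‖w‖ 1)) ^ (-α) = ∑' k : ℕ,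
      (Metric.closedBall (0 : Fin n → ℚ_[p]) ((p:ℝ)^k)).indicator
        (fun _ => ENNReal.ofReal ((1 - (p:ℝ)^(-α)) * ((p:ℝ)^(-α))^k)) w := by
  obtain ⟨K, hK⟩ := exists_pow_vec w
  have hp := p_pos (p := p)
  have hp1 := p_gt (p := p)
  have hq0 : 0 < (p:ℝ)^(-α) := Real.rpow_pos_of_pos hp _
  have hq1 : (p:ℝ)^(-α) < 1 := Real.rpow_lt_one_of_one_lt_of_neg hp1 (by linarith)
  have hmem : ∀ k : ℕ, w ∈ Metric.closedBall (0 : Fin n → ℚ_[p]) ((p:ℝ)^k) ↔ K ≤ k := by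
    intro k
    rw [Metric.mem_closedBall, dist_zero_right, ← pow_le_pow_iff_right₀ hp1, ← hK, max_le_iff]
    exact ⟨fun h => ⟨h, one_le_pow₀ hp1.le⟩, fun h => h.1⟩
  rw [← Summable.sum_add_tsum_nat_add' (k := K) ENNReal.summable]
  rw [Finset.sum_eq_zero, zero_add]
  · have : ∀ k : ℕ, (Metric.closedBall (0 : Fin n → ℚ_[p]) ((p:ℝ)^(k+K))).indicator
        (fun _ => ENNReal.ofReal ((1 - (p:ℝ)^(-α)) * ((p:ℝ)^(-α))^(k+K))) w
        = ENNReal.ofReal (((1 - (p:ℝ)^(-α)) * ((p:ℝ)^(-α))^K) * ((p:ℝ)^(-α))^k) := by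
      intro k
      rw [Set.indicator_of_mem ((hmem _).2 (by omega))]
      congr 1; ring
    simp only [this]
    rw [tsum_geom _ _ (mul_nonneg (by linarith) (by positivity)) hq0.le hq1, hK,
      ENNReal.ofReal_rpow_of_pos (by positivity)]
    congr 1
    rw [mul_comm, mul_div_assoc, div_self (by linarith), mul_one, ← Real.rpow_natCast,
      ← Real.rpow_natCast, ← Real.rpow_mul hp.le, ← Real.rpow_mul hp.le, mul_comm]
  · intro k hk
    rw [Set.indicator_of_notMem]
    rw [hmem]
    have := Finset.mem_range.1 hk
    omega

lemma J_eq (n : ℕ) (α : ℝ) (hα : (n:ℝ) < α) :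
    J p n α = ENNReal.ofReal ((1 - (p:ℝ)^(-α)) / (1 - (p:ℝ)^((n:ℝ)-α))) := by
  have hα0 : 0 < α := lt_of_le_of_lt (Nat.cast_nonneg n) hα
  have hp := p_pos (p := p)
  have hp1 := p_gt (p := p)
  have hq0 : 0 < (p:ℝ)^(-α) := Real.rpow_pos_of_pos hp _
  have hq1 : (p:ℝ)^(-α) < 1 := Real.rpow_lt_one_of_one_lt_of_neg hp1 (by linarith)
  rw [J]
  simp only [pow_identity α hα0]
  rw [lintegral_tsum]
  · rw [← tsum_geom _ _ (by linarith) (Real.rpow_pos_of_pos hp _).le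
      (Real.rpow_lt_one_of_one_lt_of_neg hp1 (by linarith))]
    congr 1
    ext k
    rw [lintegral_indicator_const Metric.isClosed_closedBall.measurableSet, mu_ball,
      ← ENNReal.ofReal_natCast, ← ENNReal.ofReal_pow hp.le, ← ENNReal.ofReal_pow (by positivity),
      ← ENNReal.ofReal_mul (mul_nonneg (by linarith) (by positivity))]
    congr 1
    rw [sub_eq_add_neg (n:ℝ), Real.rpow_add hp, Real.rpow_natCast]
    ring
  · intro k
    exact (measurable_const.indicator Metric.isClosed_closedBall.measurableSet).aemeasurable

lemma prod_eq (n : ℕ) (α : ℝ) (hα : 2 * (n:ℝ) - 1 < α) :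
    I p n n α = ENNReal.ofReal (cConst p n α) := by
  have hp1 := p_gt (p := p)
  rw [I_eq]
  have hlt : ∀ i ∈ Finset.range n, (n:ℝ) < α - i := by
    intro i hi
    have : ((i + 1 : ℕ):ℝ) ≤ n := by exact_mod_cast Finset.mem_range.1 hi
    push_cast at this
    linarith
  have h1 : ∀ x : ℝ, x < 0 → 0 < 1 - (p:ℝ)^x := fun x hx => by
    have := Real.rpow_lt_one_of_one_lt_of_neg hp1 hx
    linarith
  rw [Finset.prod_congr rfl (fun (i : ℕ) hi => J_eq n (α - i) (hlt i hi)),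
    ← ENNReal.ofReal_prod_of_nonneg]
  · congr 1
    rw [cConst, Finset.prod_div_distrib, Finset.prod_div_distrib]
    congr 1
    · rw [← Finset.prod_range_reflect]
      apply Finset.prod_congr rfl
      intro j hj
      have hj' := Finset.mem_range.1 hj
      congr 2
      rw [Nat.sub_sub, Nat.cast_sub (by omega)]
      push_cast; ring
    · apply Finset.prod_congr rfl
      intro j hj
      congr 2
      push_cast; ring
  · intro i hi
    have := hlt i hi
    have hn : (0:ℝ) ≤ n := Nat.cast_nonneg n
    exact div_nonneg (h1 _ (by linarith)).le (h1 _ (by linarith)).le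

section smith
variable {m m' : Type*} [Fintype m] [DecidableEq m] [Fintype m'] [DecidableEq m']

/-- general Smith form existence -/
def HasSmith (z : Matrix m m ℚ_[p]) : Prop :=
  ∃ (A : Matrix m m ℚ_[p]) (d : m → ℚ_[p]) (B : Matrix m m ℚ_[p]), IsGLZp A ∧ IsGLZp B ∧
    (∀ j, d j = 0 ∨ ∃ k : ℤ, d j = (p : ℚ_[p]) ^ (-k)) ∧ z = A * Matrix.diagonal d * B

lemma int_mul {A B : Matrix m m ℚ_[p]} (hA : ∀ i j, ‖A i j‖ ≤ 1) (hB : ∀ i j, ‖B i j‖ ≤ 1) :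
    ∀ i j, ‖(A * B) i j‖ ≤ 1 := fun i j => by
  rw [Matrix.mul_apply]
  exact norm_sum_le' _ _ fun k _ => norm_mul_le' (hA _ _) (hB _ _)

lemma int_one : ∀ i j, ‖(1 : Matrix m m ℚ_[p]) i j‖ ≤ 1 := fun i j => by
  rw [Matrix.one_apply]; split_ifs <;> simp

lemma gl_one : IsGLZp (1 : Matrix m m ℚ_[p]) := ⟨int_one, 1, int_one, by simp, by simp⟩

lemma gl_mul {A B : Matrix m m ℚ_[p]} (hA : IsGLZp A) (hB : IsGLZp B) : IsGLZp (A * B) := by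
  obtain ⟨hA, A', hA', h1, h2⟩ := hA
  obtain ⟨hB, B', hB', h3, h4⟩ := hB
  refine ⟨int_mul hA hB, B' * A', int_mul hB' hA', ?_, ?_⟩
  · rw [Matrix.mul_assoc, ← Matrix.mul_assoc B, h3, Matrix.one_mul, h1]
  · rw [Matrix.mul_assoc, ← Matrix.mul_assoc A', h2, Matrix.one_mul, h4]

lemma gl_sub {A : Matrix m m ℚ_[p]} (hA : IsGLZp A) (e f : m' ≃ m) :
    IsGLZp (A.submatrix e f) := by
  obtain ⟨hA, A', hA', h1, h2⟩ := hA
  refine ⟨fun i j => hA _ _, A'.submatrix f e, fun i j => hA' _ _, ?_, ?_⟩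
  · rw [Matrix.submatrix_mul_equiv, h1, Matrix.submatrix_one_equiv]
  · rw [Matrix.submatrix_mul_equiv, h2, Matrix.submatrix_one_equiv]

lemma smith_mul {P z Q : Matrix m m ℚ_[p]} (hP : IsGLZp P) (hQ : IsGLZp Q) (hz : HasSmith z) :
    HasSmith (P * z * Q) := by
  obtain ⟨A, d, B, hA, hB, hd, rfl⟩ := hz
  exact ⟨P * A, d, B * Q, gl_mul hP hA, gl_mul hB hQ, hd, by simp only [Matrix.mul_assoc]⟩

lemma smith_sub {z : Matrix m m ℚ_[p]} (e f : m' ≃ m) (hz : HasSmith (z.submatrix e f)) :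
    HasSmith z := by
  obtain ⟨A, d, B, hA, hB, hd, h⟩ := hz
  refine ⟨A.submatrix e.symm e.symm, d ∘ e.symm, B.submatrix e.symm f.symm, gl_sub hA _ _,
    gl_sub hB _ _, fun j => hd _, ?_⟩
  have : Matrix.diagonal (d ∘ e.symm) = (Matrix.diagonal d).submatrix e.symm e.symm := by
    rw [Matrix.submatrix_diagonal_equiv]
  rw [this, Matrix.submatrix_mul_equiv, Matrix.submatrix_mul_equiv, ← h]
  ext i j; simp

lemma gl_block {A : Matrix m m ℚ_[p]} {B : Matrix m' m' ℚ_[p]} (hA : IsGLZp A) (hB : IsGLZp B) :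
    IsGLZp (Matrix.fromBlocks A 0 0 B) := by
  obtain ⟨hA, A', hA', h1, h2⟩ := hA
  obtain ⟨hB, B', hB', h3, h4⟩ := hB
  refine ⟨?_, Matrix.fromBlocks A' 0 0 B', ?_, ?_, ?_⟩
  · rintro (i | i) (j | j) <;> simp [hA, hB]
  · rintro (i | i) (j | j) <;> simp [hA', hB']
  · simp [Matrix.fromBlocks_multiply, h1, h3]
  · simp [Matrix.fromBlocks_multiply, h2, h4]

lemma gl_lower {C : Matrix m' m ℚ_[p]} (hC : ∀ i j, ‖C i j‖ ≤ 1) :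
    IsGLZp (Matrix.fromBlocks (1 : Matrix m m ℚ_[p]) 0 C (1 : Matrix m' m' ℚ_[p])) := by
  refine ⟨?_, Matrix.fromBlocks 1 0 (-C) 1, ?_, ?_, ?_⟩
  · rintro (i | i) (j | j) <;> simp [hC, int_one]
  · rintro (i | i) (j | j) <;> simp [hC, int_one]
  · simp [Matrix.fromBlocks_multiply]
  · simp [Matrix.fromBlocks_multiply]

lemma gl_upper {C : Matrix m m' ℚ_[p]} (hC : ∀ i j, ‖C i j‖ ≤ 1) :
    IsGLZp (Matrix.fromBlocks (1 : Matrix m m ℚ_[p]) C 0 (1 : Matrix m' m' ℚ_[p])) := by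
  refine ⟨?_, Matrix.fromBlocks 1 (-C) 0 1, ?_, ?_, ?_⟩
  · rintro (i | i) (j | j) <;> simp [hC, int_one]
  · rintro (i | i) (j | j) <;> simp [hC, int_one]
  · simp [Matrix.fromBlocks_multiply]
  · simp [Matrix.fromBlocks_multiply]

lemma smith_block {a : Matrix m m ℚ_[p]} {s : Matrix m' m' ℚ_[p]} (ha : HasSmith a)
    (hs : HasSmith s) : HasSmith (Matrix.fromBlocks a 0 0 s) := by
  obtain ⟨A, d, B, hA, hB, hd, rfl⟩ := ha
  obtain ⟨A', d', B', hA', hB', hd', rfl⟩ := hs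
  refine ⟨Matrix.fromBlocks A 0 0 A', Sum.elim d d', Matrix.fromBlocks B 0 0 B',
    gl_block hA hA', gl_block hB hB', ?_, ?_⟩
  · rintro (j | j)
    · exact hd j
    · exact hd' j
  · rw [← Matrix.fromBlocks_diagonal, Matrix.fromBlocks_multiply, Matrix.fromBlocks_multiply]
    simp only [Matrix.zero_mul, Matrix.mul_zero, add_zero, zero_add]

lemma smith_unit (a : Matrix Unit Unit ℚ_[p]) (ha : a () () ≠ 0) : HasSmith a := by
  set x := a () ()
  have hp : (p:ℚ_[p]) ≠ 0 := pQ_ne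
  have hp' := p_pos (p := p)
  have hn := Padic.norm_eq_zpow_neg_valuation ha
  have hn1 : ‖x * (p:ℚ_[p]) ^ (-x.valuation)‖ = 1 := by
    rw [norm_mul, hn, Padic.norm_p_zpow, ← zpow_add₀ hp'.ne']; simp
  refine ⟨Matrix.of fun _ _ => x * (p:ℚ_[p]) ^ (-x.valuation), fun _ => (p:ℚ_[p]) ^ (- -x.valuation),
    1, ⟨?_, Matrix.of fun _ _ => (x * (p:ℚ_[p]) ^ (-x.valuation))⁻¹, ?_, ?_, ?_⟩, gl_one,
    fun j => Or.inr ⟨-x.valuation, rfl⟩, ?_⟩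
  · intro i j; exact hn1.le
  · intro i j
    rw [Matrix.of_apply, norm_inv, hn1]; simp
  · ext i j
    simp only [Matrix.mul_apply, Matrix.of_apply, Finset.univ_unique, Finset.sum_singleton]
    rw [mul_inv_cancel₀ (by rw [← norm_ne_zero_iff, hn1]; simp)]; simp
  · ext i j
    simp only [Matrix.mul_apply, Matrix.of_apply, Finset.univ_unique, Finset.sum_singleton]
    rw [inv_mul_cancel₀ (by rw [← norm_ne_zero_iff, hn1]; simp)]; simp
  · ext i j
    simp only [Matrix.mul_one, Matrix.mul_diagonal, Matrix.of_apply]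
    rw [mul_assoc, ← zpow_add₀ hp]; simp [x]

lemma exists_smith : ∀ (n : ℕ) (z : Matrix (Fin n) (Fin n) ℚ_[p]), HasSmith z := by
  intro n
  induction n with
  | zero => intro z; exact ⟨1, 0, 1, gl_one, gl_one, fun j => j.elim0, Subsingleton.elim _ _⟩
  | succ n ih =>
    intro z
    by_cases hz : z = 0
    · exact ⟨1, 0, 1, gl_one, gl_one, fun j => Or.inl rfl, by simp [hz]⟩
    obtain ⟨⟨i0, j0⟩, hmax⟩ := Finite.exists_max (fun ij : Fin (n+1) × Fin (n+1) => ‖z ij.1 ij.2‖)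
    have hne : z i0 j0 ≠ 0 := by
      intro h
      apply hz
      ext i j
      have := hmax (i, j)
      simp only [h, norm_zero] at this
      simpa using this
    have e0 : Unit ⊕ Fin n ≃ Fin (n+1) := Fintype.equivOfCardEq (by simp; omega)
    set e := e0.trans (Equiv.swap (e0 (Sum.inl ())) i0) with he
    set f := e0.trans (Equiv.swap (e0 (Sum.inl ())) j0) with hf
    have hei : e (Sum.inl ()) = i0 := by simp [he]
    have hfj : f (Sum.inl ()) = j0 := by simp [hf]
    apply smith_sub e f
    set w := z.submatrix e f with hw
    have hw0 : w (Sum.inl ()) (Sum.inl ()) = z i0 j0 := by simp [hw, hei, hfj]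
    have hwmax : ∀ i j, ‖w i j‖ ≤ ‖z i0 j0‖ := fun i j => hmax (e i, f j)
    rw [← Matrix.fromBlocks_toBlocks w]
    have hdet : (w.toBlocks₁₁).det = z i0 j0 := by
      rw [Matrix.det_unique]; exact hw0
    have : Invertible (w.toBlocks₁₁).det := invertibleOfNonzero (by rw [hdet]; exact hne)
    have : Invertible (w.toBlocks₁₁) := Matrix.invertibleOfDetInvertible _
    have hinv : ∀ i j, ⅟(w.toBlocks₁₁) i j = (z i0 j0)⁻¹ := by
      intro i j
      have h1 : (⅟(w.toBlocks₁₁) * w.toBlocks₁₁) () () = 1 := by rw [invOf_mul_self]; simp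
      rw [Matrix.mul_apply] at h1
      simp only [Finset.univ_unique, Finset.sum_singleton] at h1
      have h2 : w.toBlocks₁₁ default () = z i0 j0 := hw0
      rw [h2] at h1
      exact eq_inv_of_mul_eq_one_left h1
    have hq : ∀ x, ‖x‖ ≤ ‖z i0 j0‖ → ‖x * (z i0 j0)⁻¹‖ ≤ 1 := by
      intro x hx
      rw [norm_mul, norm_inv, ← div_eq_mul_inv]
      exact div_le_one_of_le₀ hx (norm_nonneg _)
    rw [Matrix.fromBlocks_eq_of_invertible₁₁]
    apply smith_mul
    · apply gl_lower
      intro i j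
      rw [Matrix.mul_apply]
      simp only [Finset.univ_unique, Finset.sum_singleton, hinv]
      exact hq _ (hwmax _ _)
    · apply gl_upper
      intro i j
      rw [Matrix.mul_apply]
      simp only [Finset.univ_unique, Finset.sum_singleton, hinv]
      rw [mul_comm]
      exact hq _ (hwmax _ _)
    · apply smith_block _ (ih _)
      apply smith_unit
      have : w.toBlocks₁₁ () () = z i0 j0 := hw0
      rw [this]; exact hne
end smith

/-- invertible matrix as a continuous linear equivalence -/
noncomputable def matE {n : ℕ} (A B : Matrix (Fin n) (Fin n) ℚ_[p]) (h1 : A * B = 1)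
    (h2 : B * A = 1) : (Fin n → ℚ_[p]) ≃L[ℚ_[p]] (Fin n → ℚ_[p]) :=
  LinearEquiv.toContinuousLinearEquiv
  { toFun := fun x => A *ᵥ x
    invFun := fun x => B *ᵥ x
    map_add' := fun x y => Matrix.mulVec_add _ _ _
    map_smul' := fun c x => Matrix.mulVec_smul _ _ _
    left_inv := fun x => by simp [h2]
    right_inv := fun x => by simp [h1] }

lemma matE_apply {n : ℕ} (A B : Matrix (Fin n) (Fin n) ℚ_[p]) (h1) (h2) (x) :
    matE A B h1 h2 x = A *ᵥ x := rfl

lemma O_mulVec {n : ℕ} {A : Matrix (Fin n) (Fin n) ℚ_[p]} (hA : ∀ i j, ‖A i j‖ ≤ 1)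
    {x : Fin n → ℚ_[p]} (hx : x ∈ Oset p n) : A *ᵥ x ∈ Oset p n := fun i =>
  norm_sum_le' Finset.univ (fun k => A i k * x k) fun k _ => norm_mul_le' (hA i k) (hx k)

lemma Gam_smith {n : ℕ} {z A B : Matrix (Fin n) (Fin n) ℚ_[p]} {d : Fin n → ℚ_[p]}
    (h : IsSmith z A d B) : Gam (fun j i => z i j) = ∏ j, ENNReal.ofReal (max ‖d j‖ 1) := by
  obtain ⟨⟨hA, A', hA', h1, h2⟩, ⟨hB, B', hB', h3, h4⟩, -, rfl⟩ := h
  have hO : matE A A' h1 h2 '' Oset p n = Oset p n := by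
    apply Set.Subset.antisymm
    · rintro _ ⟨x, hx, rfl⟩
      exact O_mulVec hA hx
    · intro x hx
      exact ⟨A' *ᵥ x, O_mulVec hA' hx, by simp [matE_apply, h1]⟩
  have hsum : ∀ (z : Matrix (Fin n) (Fin n) ℚ_[p]) (b : Fin n → ℚ_[p]),
      ∑ j, b j • (fun i => z i j) = z *ᵥ b := by
    intro z b; ext i; simp [Matrix.mulVec, dotProduct, mul_comm]
  have hL : Lat (fun j i => (A * Matrix.diagonal d * B) i j) = matE A A' h1 h2 '' Box d := by
    apply Set.Subset.antisymm
    · rintro _ ⟨a, ha, b, hb, rfl⟩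
      rw [hsum]
      refine ⟨A' *ᵥ a + Matrix.diagonal d *ᵥ (B *ᵥ b), ?_, ?_⟩
      · intro i
        rw [Pi.add_apply, Matrix.mulVec_diagonal]
        refine norm_add_le' ((O_mulVec hA' ha i).trans (le_max_right _ _)) ?_
        rw [norm_mul]
        exact (mul_le_of_le_one_right (norm_nonneg _) (O_mulVec hB hb i)).trans (le_max_left _ _)
      · rw [matE_apply, Matrix.mulVec_add]
        simp [h1, Matrix.mul_assoc]
    · rintro _ ⟨x, hx, rfl⟩
      have : ∀ i, ∃ a b : ℚ_[p], ‖a‖ ≤ 1 ∧ ‖b‖ ≤ 1 ∧ x i = a + d i * b := by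
        intro i
        have hxi := hx i
        by_cases hd : ‖d i‖ ≤ 1
        · rw [max_eq_right hd] at hxi
          exact ⟨x i, 0, hxi, by simp, by simp⟩
        · push Not at hd
          rw [max_eq_left hd.le] at hxi
          have hd0 : d i ≠ 0 := by intro h; rw [h] at hd; simp at hd; linarith
          refine ⟨0, (d i)⁻¹ * x i, by simp, ?_, by field_simp; simp⟩
          rw [norm_mul, norm_inv, inv_mul_le_iff₀ (norm_pos_iff.2 hd0), mul_one]
          exact hxi
      choose a b ha hb hab using this
      refine ⟨A *ᵥ a, O_mulVec hA ha, B' *ᵥ b, O_mulVec hB' hb, ?_⟩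
      have hx' : x = a + Matrix.diagonal d *ᵥ b := by
        ext i; rw [hab i, Pi.add_apply, Matrix.mulVec_diagonal]
      rw [hsum, matE_apply, hx', Matrix.mulVec_add]
      simp [Matrix.mul_assoc, h3]
  rw [Gam, hL, scale_set (mu p n) (Oset p n) (mu_O n), hO, mu_O, one_mul, mu_Box]

lemma gammaFn_eq {n : ℕ} (z : Matrix (Fin n) (Fin n) ℚ_[p]) :
    gammaFn z = (Gam (fun j i => z i j)).toReal := by
  have h : ∃ A d B, IsSmith z A d B := exists_smith n z
  rw [gammaFn, dif_pos h, Gam_smith h.choose_spec.choose_spec.choose_spec, ENNReal.toReal_prod]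
  apply Finset.prod_congr rfl
  intro j _
  rw [ENNReal.toReal_ofReal (le_trans zero_le_one (le_max_right _ _))]

/-- transposition, as an additive equivalence onto tuples of columns -/
def colE (p : ℕ) [Fact p.Prime] (n : ℕ) :
    Matrix (Fin n) (Fin n) ℚ_[p] ≃+ (Fin n → Fin n → ℚ_[p]) where
  toFun z j i := z i j
  invFun c := Matrix.of fun i j => c j i
  left_inv z := rfl
  right_inv c := rfl
  map_add' x y := rfl

lemma colE_cont (n : ℕ) : Continuous (colE p n) := by
  refine continuous_pi fun j => continuous_pi fun i => ?_
  exact continuous_id.matrix_elem i j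

lemma colE_symm_cont (n : ℕ) : Continuous (colE p n).symm := by
  refine continuous_matrix fun i j => ?_
  exact (continuous_apply i).comp (continuous_apply j)

lemma map_colE (n : ℕ) (vol : Measure (Matrix (Fin n) (Fin n) ℚ_[p])) [vol.IsAddHaarMeasure]
    (hnorm : vol {z : Matrix (Fin n) (Fin n) ℚ_[p] | ∀ i j, ‖z i j‖ ≤ 1} = 1) :
    vol.map (colE p n) = Measure.pi fun _ => mu p n := by
  have : (vol.map (colE p n)).IsAddHaarMeasure :=
    (colE p n).isAddHaarMeasure_map vol (colE_cont n) (colE_symm_cont n)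
  have hpi : (Measure.pi fun _ : Fin n => mu p n) (Set.pi Set.univ fun _ => Oset p n) = 1 := by
    rw [Measure.pi_pi]; simp [mu_O]
  rw [eq_of_unit (Measure.pi fun _ : Fin n => mu p n) (vol.map (colE p n)) _ hpi]
  have hcl : IsClosed (Oset p n) := by
    have : Oset p n = ⋂ i, {a | ‖a i‖ ≤ 1} := by ext; simp [Oset]
    rw [this]
    exact isClosed_iInter fun i => isClosed_le (by fun_prop) continuous_const
  have hms : MeasurableSet (Set.pi Set.univ fun _ : Fin n => Oset p n) :=
    (isClosed_set_pi fun _ _ => hcl).measurableSet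
  rw [Measure.map_apply (colE_cont n).measurable hms]
  have : (colE p n) ⁻¹' (Set.pi Set.univ fun _ => Oset p n)
      = {z : Matrix (Fin n) (Fin n) ℚ_[p] | ∀ i j, ‖z i j‖ ≤ 1} := by
    ext z
    simp only [Set.mem_preimage, Set.mem_pi, Set.mem_univ, true_imp_iff]
    exact ⟨fun h i j => h j i, fun h j i => h i j⟩
  rw [this, hnorm, one_smul]

end Hua

/-- for `α > 2n - 1`,
`∫ γ(z)^{-α} d vol(z) = ∏_{j=1}^n (1-p^{-α+n-j})/(1-p^{-α+n+j-1})`, the integral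
being convergent. -/
theorem hua_integral (n : ℕ) (vol : Measure (Matrix (Fin n) (Fin n) ℚ_[p]))
    [vol.IsAddHaarMeasure]
    (hnorm : vol {z : Matrix (Fin n) (Fin n) ℚ_[p] | ∀ i j, ‖z i j‖ ≤ 1} = 1)
    (α : ℝ) (hα : 2 * n - 1 < α) :
    Integrable (fun z : Matrix (Fin n) (Fin n) ℚ_[p] => gammaFn z ^ (-α)) vol ∧
    ∫ z : Matrix (Fin n) (Fin n) ℚ_[p], gammaFn z ^ (-α) ∂vol = cConst p n α := by
  have hG : ∀ z : Matrix (Fin n) (Fin n) ℚ_[p],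
      gammaFn z ^ (-α) = (Hua.Gam (Hua.colE p n z)).toReal ^ (-α) := by
    intro z; rw [Hua.gammaFn_eq]; rfl
  have hpos : ∀ c : Fin n → Fin n → ℚ_[p], 0 < (Hua.Gam c).toReal := fun c =>
    ENNReal.toReal_pos (lt_of_lt_of_le one_pos (Hua.Gam_ge c)).ne' (Hua.Gam_ne_top c)
  have hmeas : Measurable fun z : Matrix (Fin n) (Fin n) ℚ_[p] => gammaFn z ^ (-α) := by
    simp only [hG]
    exact ((Hua.Gam_continuous.measurable.comp (Hua.colE_cont n).measurable).ennreal_toReal).pow_const _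
  have hnn : ∀ z : Matrix (Fin n) (Fin n) ℚ_[p], 0 ≤ gammaFn z ^ (-α) := fun z => by
    rw [hG]; exact (Real.rpow_pos_of_pos (hpos _) _).le
  have hl : ∫⁻ z : Matrix (Fin n) (Fin n) ℚ_[p], ENNReal.ofReal (gammaFn z ^ (-α)) ∂vol
      = ENNReal.ofReal (cConst p n α) := by
    rw [← Hua.prod_eq n α hα, Hua.I, ← Hua.map_colE n vol hnorm,
      lintegral_map (Hua.Gam_continuous.measurable.pow_const _) (Hua.colE_cont n).measurable]
    apply lintegral_congr
    intro z
    rw [hG, ← ENNReal.ofReal_rpow_of_pos (hpos _), ENNReal.ofReal_toReal (Hua.Gam_ne_top _)]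
  have hc : 0 ≤ cConst p n α := by
    apply Finset.prod_nonneg
    intro j hj
    have hj' : ((j + 1 : ℕ) : ℝ) ≤ n := by exact_mod_cast Finset.mem_range.1 hj
    have h1 : ∀ x : ℝ, x < 0 → 0 ≤ 1 - (p:ℝ)^x := fun x hx => by
      have := Real.rpow_lt_one_of_one_lt_of_neg (Hua.p_gt (p := p)) hx
      linarith
    have h0 : (0:ℝ) ≤ (j:ℕ) := Nat.cast_nonneg j
    push_cast at hj'
    exact div_nonneg (h1 _ (by push_cast; linarith)) (h1 _ (by push_cast; linarith))
  refine ⟨⟨hmeas.aestronglyMeasurable, ?_⟩, ?_⟩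
  · rw [hasFiniteIntegral_iff_ofReal (Filter.Eventually.of_forall hnn), hl]
    exact ENNReal.ofReal_lt_top
  · rw [integral_eq_lintegral_of_nonneg_ae (Filter.Eventually.of_forall hnn)
      hmeas.aestronglyMeasurable, hl, ENNReal.toReal_ofReal hc]
end

section
/- For n = 1 and s > -1, the probability measure μ_s on Q_p defined by dμ_s(z) = c^{-1} max(|z|_p,1)^{-s-2} d vol(z), with c = (1-p^{-s-2})/(1-p^{-s-1}), satisfies: the pushforward of μ_s under z ↦ z^{-1} equals the measure |z|_p^{s} · max(|z|_p,1)^{-s-2} c^{-1} d vol(z); i.e., dμ_s(z^{-1}) = |z|_p^s dμ_s(z). -/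
open MeasureTheory Matrix
open scoped ENNReal NNReal BigOperators

variable {p : ℕ} [Fact p.Prime]

open Metric in
theorem hua_vol_step (vol : Measure ℚ_[p]) [vol.IsAddHaarMeasure] (k : ℤ) :
    vol (closedBall 0 ((p : ℝ) ^ k)) = p * vol (closedBall 0 ((p : ℝ) ^ (k - 1))) := by
  have hp0 : (0 : ℝ) < p := by exact_mod_cast (Fact.out : p.Prime).pos
  have hpp : (p : ℚ_[p]) ≠ 0 := by exact_mod_cast (Fact.out : p.Prime).ne_zero
  have hnk : ‖(p : ℚ_[p]) ^ (-k)‖ = (p : ℝ) ^ k := by simp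
  have hnk' : ‖(p : ℚ_[p]) ^ k‖ = (p : ℝ) ^ (-k) := by simp
  have hlt : (p : ℝ) ^ (k - 1) < (p : ℝ) ^ k :=
    zpow_lt_zpow_right₀ (by exact_mod_cast (Fact.out : p.Prime).one_lt) (by omega)
  have hU : closedBall (0 : ℚ_[p]) ((p : ℝ) ^ k) =
      ⋃ i ∈ Finset.range p, closedBall ((i : ℚ_[p]) * (p : ℚ_[p]) ^ (-k)) ((p : ℝ) ^ (k - 1)) := by
    ext z
    simp only [mem_closedBall, sub_zero, Set.mem_iUnion, Finset.mem_range, exists_prop,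
      dist_eq_norm]
    constructor
    · intro hz
      have h1 : ‖z * (p : ℚ_[p]) ^ k‖ ≤ 1 := by
        rw [norm_mul, hnk', _root_.zpow_neg, ← div_eq_mul_inv]
        exact (div_le_one (by positivity)).2 hz
      obtain ⟨n, hn, hx⟩ := PadicInt.exists_mem_range (p := p) ⟨_, h1⟩
      refine ⟨n, hn, ?_⟩
      rw [PadicInt.maximalIdeal_eq_span_p, Ideal.mem_span_singleton,
        ← PadicInt.norm_lt_one_iff_dvd, PadicInt.norm_def] at hx
      rw [← Padic.norm_lt_pow_iff_norm_le_pow_sub_one]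
      have : z - n * (p : ℚ_[p]) ^ (-k) = (z * (p : ℚ_[p]) ^ k - n) * (p : ℚ_[p]) ^ (-k) := by
        rw [sub_mul, mul_assoc, ← zpow_add₀ hpp]; simp
      rw [this, norm_mul, hnk]
      have hx' : ‖z * (p : ℚ_[p]) ^ k - n‖ < 1 := hx
      exact mul_lt_of_lt_one_left (by positivity) hx'
    · rintro ⟨n, -, hz⟩
      have : z = (z - n * (p : ℚ_[p]) ^ (-k)) + n * (p : ℚ_[p]) ^ (-k) := by ring
      rw [this]
      refine (Padic.nonarchimedean _ _).trans (max_le (hz.trans hlt.le) ?_)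
      rw [norm_mul, hnk]
      refine mul_le_of_le_one_left (by positivity) ?_
      exact_mod_cast Padic.norm_int_le_one (p := p) (n : ℤ)
  rw [hU, measure_biUnion_finset]
  · simp [Measure.addHaar_closedBall_center]
  · intro i hi j hj hij
    rcases IsUltrametricDist.closedBall_eq_or_disjoint ((i : ℚ_[p]) * (p : ℚ_[p]) ^ (-k))
      ((j : ℚ_[p]) * (p : ℚ_[p]) ^ (-k)) ((p : ℝ) ^ (k - 1)) with h | h
    · exfalso
      have hm : (i : ℚ_[p]) * (p : ℚ_[p]) ^ (-k) ∈
          closedBall ((j : ℚ_[p]) * (p : ℚ_[p]) ^ (-k)) ((p : ℝ) ^ (k - 1)) := by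
        rw [← h]; exact mem_closedBall_self (by positivity)
      rw [mem_closedBall, dist_eq_norm, ← Padic.norm_lt_pow_iff_norm_le_pow_sub_one, ← sub_mul,
        norm_mul, hnk, mul_lt_iff_lt_one_left (by positivity)] at hm
      have hm' : ‖(((i : ℤ) - (j : ℤ) : ℤ) : ℚ_[p])‖ < 1 := by push_cast; exact hm
      rw [Padic.norm_intCast_lt_one_iff] at hm'
      simp only [Finset.coe_range, Set.mem_Iio] at hi hj
      obtain ⟨c, hc⟩ := hm'
      have : c = 0 := by
        rcases lt_trichotomy c 0 with h | h | h
        · nlinarith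
        · exact h
        · nlinarith
      subst this
      omega
    · exact h
  · intro i _
    exact isClosed_closedBall.measurableSet

open Metric in
theorem hua_vol_ball (vol : Measure ℚ_[p]) [vol.IsAddHaarMeasure]
    (hnorm : vol {z : ℚ_[p] | ‖z‖ ≤ 1} = 1) (a : ℚ_[p]) (k : ℤ) :
    vol (closedBall a ((p : ℝ) ^ k)) = ENNReal.ofReal ((p : ℝ) ^ k) := by
  have hp0 : (0 : ℝ) < p := by exact_mod_cast (Fact.out : p.Prime).pos
  have hofp : ENNReal.ofReal (p : ℝ) = p := ENNReal.ofReal_natCast p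
  rw [Measure.addHaar_closedBall_center]
  induction k using Int.induction_on with
  | zero =>
    rw [zpow_zero, ENNReal.ofReal_one, ← hnorm]
    congr 1; ext z; simp
  | succ n ih =>
    rw [hua_vol_step, add_sub_cancel_right, ih, ← hofp, ← ENNReal.ofReal_mul hp0.le,
      zpow_add_one₀ hp0.ne', mul_comm]
  | pred n ih =>
    rw [hua_vol_step] at ih
    have : (p : ℝ) ^ (-(n : ℤ)) = p * (p : ℝ) ^ (-(n : ℤ) - 1) := by
      rw [zpow_sub_one₀ hp0.ne']; field_simp
    rw [this, ENNReal.ofReal_mul hp0.le, hofp] at ih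
    exact (ENNReal.mul_right_inj (by exact_mod_cast (Fact.out : p.Prime).ne_zero)
      (ENNReal.natCast_ne_top p)).1 ih

open Metric in
theorem hua_inv_ball {a : ℚ_[p]} {r : ℝ} (hr : r < ‖a‖) (ha : a ≠ 0) :
    (fun z : ℚ_[p] => z⁻¹) ⁻¹' closedBall a r = closedBall a⁻¹ (r / ‖a‖ ^ 2) := by
  have hpos : 0 < ‖a‖ := norm_pos_iff.2 ha
  have key : ∀ z : ℚ_[p], ‖z‖ = ‖a‖⁻¹ → ‖z - a⁻¹‖ = ‖z⁻¹ - a‖ / ‖a‖ ^ 2 := by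
    intro z hz
    have hz0 : z ≠ 0 := by
      rw [← norm_pos_iff, hz]; positivity
    have : z - a⁻¹ = -((z⁻¹ - a) * z * a⁻¹) := by field_simp; ring
    rw [this, norm_neg, norm_mul, norm_mul, norm_inv, hz]
    field_simp
  ext z
  simp only [Set.mem_preimage, mem_closedBall, dist_eq_norm]
  constructor
  · intro h
    have h1 := Padic.norm_eq_of_norm_sub_lt_right (h.trans_lt hr)
    rw [norm_inv] at h1
    rw [key z (by rw [← h1, inv_inv])]
    gcongr
  · intro h
    have h1 : ‖z‖ = ‖a⁻¹‖ := by
      apply Padic.norm_eq_of_norm_sub_lt_right (h.trans_lt _)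
      rw [norm_inv, div_lt_iff₀ (by positivity)]
      field_simp
      exact hr
    rw [norm_inv] at h1
    rw [key z h1] at h
    exact (div_le_div_iff_of_pos_right (by positivity)).1 h

open Metric in
/-- Countable family of balls avoiding zero, together with `{0}` and `∅`. -/
def huaFamily (p : ℕ) [Fact p.Prime] : Set (Set ℚ_[p]) :=
  {∅, {0}} ∪ {t | ∃ (q : ℚ) (k : ℤ), (p : ℝ) ^ k < ‖(q : ℚ_[p])‖ ∧
    t = closedBall (q : ℚ_[p]) ((p : ℝ) ^ k)}

theorem huaFamily_countable : (huaFamily p).Countable := by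
  refine Set.Countable.union (by simp) ?_
  refine (Set.countable_range (fun x : ℚ × ℤ =>
    Metric.closedBall (x.1 : ℚ_[p]) ((p : ℝ) ^ x.2))).mono ?_
  rintro t ⟨q, k, -, rfl⟩
  exact ⟨(q, k), rfl⟩

theorem huaFamily_inter {s t : Set ℚ_[p]} (hs : s ∈ huaFamily p) (ht : t ∈ huaFamily p) :
    s ∩ t ∈ huaFamily p := by
  have hE : (∅ : Set ℚ_[p]) ∈ huaFamily p := by simp [huaFamily]
  have hZ : ({0} : Set ℚ_[p]) ∈ huaFamily p := by simp [huaFamily]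
  have hz : ∀ u : Set ℚ_[p], {0} ∩ u ∈ huaFamily p := by
    intro u
    rcases Set.subset_singleton_iff_eq.1 (Set.inter_subset_left : {(0 : ℚ_[p])} ∩ u ⊆ {0})
      with h | h <;> rw [h] <;> assumption
  have hs0 := hs
  have ht0 := ht
  rcases hs with (rfl | rfl) | ⟨q, k, hq, rfl⟩
  · simpa using hE
  · exact hz t
  rcases ht with (rfl | rfl) | ⟨q', k', hq', rfl⟩
  · simpa using hE
  · rw [Set.inter_comm]; exact hz _
  rcases IsUltrametricDist.closedBall_subset_trichotomy (q : ℚ_[p]) (q' : ℚ_[p])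
    ((p : ℝ) ^ k) ((p : ℝ) ^ k') with h | h | h
  · rwa [Set.inter_eq_left.2 h]
  · rwa [Set.inter_eq_right.2 h]
  · rw [h.inter_eq]; exact hE

open Metric in
theorem huaFamily_nhds {U : Set ℚ_[p]} (hU : IsOpen U) {x : ℚ_[p]} (hx : x ∈ U) :
    ∃ t ∈ huaFamily p, x ∈ t ∧ t ⊆ U := by
  by_cases h0 : x = 0
  · subst h0
    exact ⟨{0}, by simp [huaFamily], rfl, by simpa using hx⟩
  obtain ⟨ε, hε, hb⟩ := Metric.isOpen_iff.1 hU x hx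
  have hpos : 0 < ‖x‖ := norm_pos_iff.2 h0
  have hp0 : (0 : ℝ) < p := by exact_mod_cast (Fact.out : p.Prime).pos
  obtain ⟨n, hn⟩ := exists_pow_lt_of_lt_one (lt_min hε hpos)
    (inv_lt_one_of_one_lt₀ (by exact_mod_cast (Fact.out : p.Prime).one_lt : (1 : ℝ) < p))
  have hk : ((p : ℝ)⁻¹) ^ n = (p : ℝ) ^ (-(n : ℤ)) := by simp
  rw [hk] at hn
  have hkpos : (0 : ℝ) < (p : ℝ) ^ (-(n : ℤ)) := by positivity
  obtain ⟨q, hq⟩ := Padic.rat_dense p x hkpos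
  have hqn : ‖x‖ = ‖(q : ℚ_[p])‖ :=
    Padic.norm_eq_of_norm_sub_lt_left (hq.trans (hn.trans_le (min_le_right _ _)))
  have hmem : x ∈ closedBall (q : ℚ_[p]) ((p : ℝ) ^ (-(n : ℤ))) := by
    rw [mem_closedBall, dist_eq_norm]; exact hq.le
  refine ⟨closedBall (q : ℚ_[p]) ((p : ℝ) ^ (-(n : ℤ))), Or.inr ⟨q, _, ?_, rfl⟩, hmem, ?_⟩
  · rw [← hqn]; exact hn.trans_le (min_le_right _ _)
  · rw [IsUltrametricDist.closedBall_eq_of_mem hmem]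
    exact (closedBall_subset_ball (hn.trans_le (min_le_left _ _))).trans hb

theorem huaFamily_measurable {t : Set ℚ_[p]} (ht : t ∈ huaFamily p) : MeasurableSet t := by
  rcases ht with (rfl | rfl) | ⟨q, k, hq, rfl⟩
  · exact MeasurableSet.empty
  · exact isClosed_singleton.measurableSet
  · exact Metric.isClosed_closedBall.measurableSet

theorem huaFamily_gen :
    (inferInstance : MeasurableSpace ℚ_[p]) = MeasurableSpace.generateFrom (huaFamily p) := by
  apply le_antisymm
  · change borel _ ≤ _
    refine MeasurableSpace.generateFrom_le fun U hU => ?_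
    have : U = ⋃₀ {t ∈ huaFamily p | t ⊆ U} := by
      ext x
      constructor
      · intro hx
        obtain ⟨t, ht, hxt, htU⟩ := huaFamily_nhds hU hx
        exact ⟨t, ⟨ht, htU⟩, hxt⟩
      · rintro ⟨t, ⟨_, htU⟩, hxt⟩
        exact htU hxt
    rw [this]
    refine MeasurableSet.sUnion (huaFamily_countable.mono fun t ht => ht.1) fun t ht => ?_
    exact MeasurableSpace.measurableSet_generateFrom ht.1
  · exact MeasurableSpace.generateFrom_le fun t ht => huaFamily_measurable ht

theorem hua_real_identity {x r s : ℝ} (hx : 0 < x) :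
    (max x⁻¹ 1) ^ (-s - 2) * (r / x ^ 2) = x ^ s * (max x 1) ^ (-s - 2) * r := by
  have h1 : max x⁻¹ 1 = max x 1 / x := by
    rw [← max_div_div_right hx.le, div_self hx.ne', one_div, max_comm]
  rw [h1, Real.div_rpow (by positivity) hx.le]
  have h2 : x ^ (-s - 2) = (x ^ s * x ^ 2)⁻¹ := by
    rw [← Real.rpow_natCast x 2, ← Real.rpow_add hx, ← Real.rpow_neg hx.le]
    congr 1; push_cast; ring
  rw [h2]
  have : x ^ s ≠ 0 := (Real.rpow_pos_of_pos hx s).ne'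
  field_simp

/-- for `n = 1`, `s > -1`, the pushforward of
`dμ_s(z) = c⁻¹ max(|z|,1)^{-s-2} d vol(z)` under `z ↦ z⁻¹` is
`c⁻¹ |z|^s max(|z|,1)^{-s-2} d vol(z)`. -/
theorem map_inv_hua_rank_one (vol : Measure ℚ_[p]) [vol.IsAddHaarMeasure]
    (hnorm : vol {z : ℚ_[p] | ‖z‖ ≤ 1} = 1) (s : ℝ) (hs : -1 < s) :
    Measure.map (fun z : ℚ_[p] => z⁻¹)
        (vol.withDensity fun z => ENNReal.ofReal
          (((1 - (p : ℝ) ^ (-s - 2)) / (1 - (p : ℝ) ^ (-s - 1)))⁻¹ *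
            (max ‖z‖ 1) ^ (-s - 2))) =
      vol.withDensity fun z => ENNReal.ofReal
        (((1 - (p : ℝ) ^ (-s - 2)) / (1 - (p : ℝ) ^ (-s - 1)))⁻¹ *
          (‖z‖ ^ s * (max ‖z‖ 1) ^ (-s - 2))) := by
  set C := ((1 - (p : ℝ) ^ (-s - 2)) / (1 - (p : ℝ) ^ (-s - 1)))⁻¹ with hC
  have hp0 : (0 : ℝ) < p := by exact_mod_cast (Fact.out : p.Prime).pos
  have hinv : Measurable (fun z : ℚ_[p] => z⁻¹) := measurable_inv
  have hv0 : vol {(0 : ℚ_[p])} = 0 := measure_singleton 0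
  have main : ∀ t ∈ huaFamily p,
      Measure.map (fun z : ℚ_[p] => z⁻¹)
        (vol.withDensity fun z => ENNReal.ofReal (C * (max ‖z‖ 1) ^ (-s - 2))) t ≠ ∞ ∧
      Measure.map (fun z : ℚ_[p] => z⁻¹)
        (vol.withDensity fun z => ENNReal.ofReal (C * (max ‖z‖ 1) ^ (-s - 2))) t =
      (vol.withDensity fun z => ENNReal.ofReal (C * (‖z‖ ^ s * (max ‖z‖ 1) ^ (-s - 2)))) t := by
    intro t ht
    have hm := huaFamily_measurable ht
    rw [Measure.map_apply hinv hm]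
    rcases ht with (rfl | rfl) | ⟨q, k, hq, rfl⟩
    · simp
    · have : (fun z : ℚ_[p] => z⁻¹) ⁻¹' {0} = {0} := by ext z; simp
      rw [this, withDensity_absolutelyContinuous _ _ hv0, withDensity_absolutelyContinuous _ _ hv0]
      simp
    · set a : ℚ_[p] := (q : ℚ_[p])
      have hpos : 0 < ‖a‖ := lt_trans (by positivity) hq
      have ha : a ≠ 0 := norm_pos_iff.1 hpos
      have hR : (p : ℝ) ^ k / ‖a‖ ^ 2 = (p : ℝ) ^ (k + 2 * a.valuation) := by
        rw [Padic.norm_eq_zpow_neg_valuation ha, zpow_add₀ hp0.ne', _root_.zpow_neg, inv_pow,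
          div_inv_eq_mul, mul_comm 2 a.valuation, _root_.zpow_mul]
        norm_cast
      have hlt : (p : ℝ) ^ k / ‖a‖ ^ 2 < ‖a⁻¹‖ := by
        rw [norm_inv, div_lt_iff₀ (by positivity)]
        field_simp
        exact hq
      have e1 : (vol.withDensity fun z => ENNReal.ofReal (C * (max ‖z‖ 1) ^ (-s - 2)))
          (Metric.closedBall a⁻¹ ((p : ℝ) ^ k / ‖a‖ ^ 2)) =
          ENNReal.ofReal (C * (max ‖a‖⁻¹ 1) ^ (-s - 2)) *
            ENNReal.ofReal ((p : ℝ) ^ k / ‖a‖ ^ 2) := by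
        rw [withDensity_apply _ Metric.isClosed_closedBall.measurableSet,
          setLIntegral_congr_fun (g := fun _ => ENNReal.ofReal (C * (max ‖a‖⁻¹ 1) ^ (-s - 2)))
            Metric.isClosed_closedBall.measurableSet, setLIntegral_const, hR,
          hua_vol_ball vol hnorm]
        intro z hz
        rw [Metric.mem_closedBall, dist_eq_norm] at hz
        have := Padic.norm_eq_of_norm_sub_lt_right (hz.trans_lt hlt)
        simp only [this, norm_inv]
      have e2 : (vol.withDensity fun z =>
            ENNReal.ofReal (C * (‖z‖ ^ s * (max ‖z‖ 1) ^ (-s - 2))))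
          (Metric.closedBall a ((p : ℝ) ^ k)) =
          ENNReal.ofReal (C * (‖a‖ ^ s * (max ‖a‖ 1) ^ (-s - 2))) *
            ENNReal.ofReal ((p : ℝ) ^ k) := by
        rw [withDensity_apply _ Metric.isClosed_closedBall.measurableSet,
          setLIntegral_congr_fun
            (g := fun _ => ENNReal.ofReal (C * (‖a‖ ^ s * (max ‖a‖ 1) ^ (-s - 2))))
            Metric.isClosed_closedBall.measurableSet, setLIntegral_const,
          hua_vol_ball vol hnorm]
        intro z hz
        rw [Metric.mem_closedBall, dist_eq_norm] at hz
        have := Padic.norm_eq_of_norm_sub_lt_right (hz.trans_lt hq)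
        simp only [this]
      rw [hua_inv_ball hq ha, e1, e2]
      refine ⟨ENNReal.mul_ne_top ENNReal.ofReal_ne_top ENNReal.ofReal_ne_top, ?_⟩
      rw [← ENNReal.ofReal_mul' (by positivity), ← ENNReal.ofReal_mul' (by positivity),
        mul_assoc, mul_assoc, hua_real_identity hpos]
  refine Measure.ext_of_generateFrom_of_cover huaFamily_gen huaFamily_countable
    (fun s hs t ht _ => huaFamily_inter hs ht) ?_ (fun t ht => (main t ht).1)
    (fun t ht u hu => (main _ (huaFamily_inter hu ht)).2) (fun t ht => (main t ht).2)
  refine Set.eq_univ_of_forall fun x => ?_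
  obtain ⟨t, ht, hxt, -⟩ := huaFamily_nhds isOpen_univ (Set.mem_univ x)
  exact ⟨t, ht, hxt⟩
end
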